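/- arXiv:2309.11292 — 2 statements merged into one kernel-verified Lean document; each statement's English description precedes it below -/
import Mathlib

section
/- For all integers k ≥ 1, q ≥ 1, every 𝐧 = (n₁,…,n_q) ∈ ℕ^q, every α ∈ ℝ₊^k, and every k×q real matrix S with columns s₁,…,s_q, the multivariate moment of the Dirichlet distribution satisfies ∫_{Δ^{k−1}} ∏_{j=1}^q (s_j·x)^{n_j} dDir_α(x) = (n₁!⋯n_q!)/((α₁+⋯+α_k)_{n₁+⋯+n_q}) · Z_𝐧(Ω_𝐧[S;α]), where (θ)_m = θ(θ+1)⋯(θ+m−1) is the Pochhammer symbol. -/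
open Finset MeasureTheory Nat
open scoped Classical

/-- `col(A) = ∑_𝐚 A(𝐚) • 𝐚`, the color count vector of a colored partition. -/
def colA {q : ℕ} (A : (Fin q → ℕ) →₀ ℕ) : Fin q → ℕ :=
  fun j => ∑ a ∈ A.support, A a * a j

/-- The set of `q`-colored partitions of `𝐧`: finitely supported `A : ℕ^q → ℕ` with
`A 0 = 0` (support in `ℕ^q_*`) and `col(A) = 𝐧`. -/
def CPartSet {q : ℕ} (n : Fin q → ℕ) : Set ((Fin q → ℕ) →₀ ℕ) :=
  {A | A 0 = 0 ∧ colA A = n}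

/-- The multinomial coefficient `M_𝐧(A)` of a colored partition `A ⊨ 𝐧`. -/
noncomputable def Mcoef {q : ℕ} (n : Fin q → ℕ) (A : (Fin q → ℕ) →₀ ℕ) : ℝ :=
  (∏ j, (n j)! : ℝ) *
    ∏ a ∈ A.support,
      ((Nat.multinomial Finset.univ a : ℝ) ^ A a / ((∑ j, a j : ℝ) ^ A a * (A a)!))

/-- The refined cycle index polynomial
`Z_𝐧(𝐭) = (1/𝐧!) ∑_{A ⊨ 𝐧} M_𝐧(A) ∏_{𝐚 ∈ supp A} t_𝐚^{A(𝐚)}`. -/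
noncomputable def Zpoly {q : ℕ} (n : Fin q → ℕ) (t : (Fin q → ℕ) → ℝ) : ℝ :=
  (∏ j, (n j)! : ℝ)⁻¹ *
    ∑ᶠ A ∈ CPartSet n, Mcoef n A * ∏ a ∈ A.support, t a ^ A a

/-- Multivariate Beta function `B(α₁,…,α_k) = Γ(α₁)⋯Γ(α_k)/Γ(α₁+⋯+α_k)`. -/
noncomputable def multiBeta {k : ℕ} (α : Fin k → ℝ) : ℝ :=
  (∏ i, Real.Gamma (α i)) / Real.Gamma (∑ i, α i)

/-- The expectation of `f` under the Dirichlet distribution `Dir_α` on the standard simplex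
`Δ^{k-1} ⊆ ℝ^{k+1}`, computed in the chart given by the first `k` coordinates:
the last coordinate is `1 - ∑ y`, and the density is
`y₁^{α₁-1}⋯y_k^{α_k-1}(1-∑y)^{α_{k+1}-1}/B(α)`. -/
noncomputable def dirMoment {k : ℕ} (α : Fin (k + 1) → ℝ) (f : (Fin (k + 1) → ℝ) → ℝ) : ℝ :=
  (∫ y in {y : Fin k → ℝ | (∀ i, 0 ≤ y i) ∧ ∑ i, y i ≤ 1},
      f (Fin.snoc y (1 - ∑ i, y i)) *
        ((∏ i, y i ^ (α (Fin.castSucc i) - 1)) * (1 - ∑ i, y i) ^ (α (Fin.last k) - 1))) /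
    multiBeta α

section PowerSeriesIdentities

open MvPowerSeries

variable {q : ℕ}

/-- The Euler operator `∑ⱼ Xⱼ ∂/∂Xⱼ`, which multiplies the coefficient at `m` by `|m|`. -/
noncomputable def eulerOp (F : MvPowerSeries (Fin q) ℝ) : MvPowerSeries (Fin q) ℝ :=
  fun m => (m.degree : ℝ) * coeff m F

lemma coeff_eulerOp (F : MvPowerSeries (Fin q) ℝ) (m : Fin q →₀ ℕ) :
    coeff m (eulerOp F) = (m.degree : ℝ) * coeff m F := rfl

lemma eulerOp_one : eulerOp (1 : MvPowerSeries (Fin q) ℝ) = 0 := by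
  ext m
  by_cases hm : m = 0 <;> simp [coeff_eulerOp, coeff_one, hm]

lemma eulerOp_mul (F G : MvPowerSeries (Fin q) ℝ) :
    eulerOp (F * G) = eulerOp F * G + F * eulerOp G := by
  ext m
  rw [coeff_eulerOp, map_add, coeff_mul, coeff_mul, coeff_mul, mul_sum, ← sum_add_distrib]
  refine sum_congr rfl fun p hp => ?_
  rw [← mem_antidiagonal.1 hp, coeff_eulerOp, coeff_eulerOp, map_add]
  push_cast
  ring

lemma eulerOp_prod {ι : Type*} (s : Finset ι) (F H : ι → MvPowerSeries (Fin q) ℝ)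
    (h : ∀ i ∈ s, eulerOp (F i) = H i * F i) :
    eulerOp (∏ i ∈ s, F i) = (∑ i ∈ s, H i) * ∏ i ∈ s, F i := by
  induction s using Finset.induction_on with
  | empty => simp [eulerOp_one]
  | insert i s hi ih =>
    rw [prod_insert hi, sum_insert hi, eulerOp_mul, h i (mem_insert_self i s),
      ih fun j hj => h j (mem_insert_of_mem hj)]
    ring

/-- Solutions of `eulerOp F = H * F` are determined by their constant coefficient. -/
lemma eq_of_eulerOp_eq {F G H : MvPowerSeries (Fin q) ℝ} (hH : coeff 0 H = 0)
    (hF : eulerOp F = H * F) (hG : eulerOp G = H * G) (h0 : coeff 0 F = coeff 0 G) : F = G := by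
  have key : ∀ (d : ℕ) (m : Fin q →₀ ℕ), m.degree = d → coeff m F = coeff m G := by
    intro d
    induction d using Nat.strong_induction_on with
    | _ d ih =>
      intro m hm
      by_cases hm0 : m = 0
      · rw [hm0, h0]
      have hd : (m.degree : ℝ) ≠ 0 := by
        simpa [Finsupp.degree_eq_zero_iff] using hm0
      apply mul_left_cancel₀ hd
      rw [← coeff_eulerOp, ← coeff_eulerOp, hF, hG, coeff_mul, coeff_mul]
      refine sum_congr rfl fun p hp => ?_
      by_cases hp0 : p.1 = 0
      · simp [hp0, hH]
      have hdeg : p.1.degree + p.2.degree = d := by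
        rw [← map_add, mem_antidiagonal.1 hp, hm]
      have hpos : p.1.degree ≠ 0 := by simpa [Finsupp.degree_eq_zero_iff] using hp0
      rw [ih p.2.degree (by omega) p.2 rfl]
  ext m
  exact key _ m rfl

/-- The series `∑_m g(|m|) s^m / m! X^m`. -/
noncomputable def expSeries (g : ℕ → ℝ) (s : Fin q → ℝ) : MvPowerSeries (Fin q) ℝ :=
  fun m => g m.degree * ∏ j, s j ^ m j / (m j)!

lemma coeff_expSeries (g : ℕ → ℝ) (s : Fin q → ℝ) (m : Fin q →₀ ℕ) :
    coeff m (expSeries g s) = g m.degree * ∏ j, s j ^ m j / (m j)! := rfl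

/-- The linear form `∑ⱼ sⱼ Xⱼ`. -/
noncomputable def linForm (s : Fin q → ℝ) : MvPowerSeries (Fin q) ℝ :=
  ∑ j, monomial (Finsupp.single j 1) (s j)

lemma coeff_zero_linForm (s : Fin q → ℝ) : coeff 0 (linForm s) = 0 := by
  rw [linForm, map_sum]
  refine sum_eq_zero fun j _ => ?_
  rw [coeff_monomial, if_neg]
  intro h
  simpa using DFunLike.congr_fun h j

lemma coeff_linForm_mul_expSeries (g : ℕ → ℝ) (s : Fin q → ℝ) (m : Fin q →₀ ℕ) :
    coeff m (linForm s * expSeries g s) =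
      m.degree * (g (m.degree - 1) * ∏ j, s j ^ m j / (m j)!) := by
  have hdeg : (m.degree : ℝ) = ∑ j, (m j : ℝ) := by
    rw [Finsupp.degree_eq_sum]
    push_cast
    rfl
  rw [linForm, sum_mul, map_sum, hdeg, sum_mul]
  refine sum_congr rfl fun j _ => ?_
  rw [coeff_monomial_mul]
  by_cases hj : m j = 0
  · have : ¬ Finsupp.single j 1 ≤ m := fun h => by simpa [hj] using h j
    simp [hj, this]
  obtain ⟨m, rfl⟩ : ∃ m', m = m' + Finsupp.single j 1 := by
    refine ⟨m - Finsupp.single j 1, (tsub_add_cancel_of_le ?_).symm⟩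
    rw [Finsupp.single_le_iff]
    omega
  rw [if_pos le_add_self, add_tsub_cancel_right, coeff_expSeries, map_add,
    Finsupp.degree_single, Nat.add_sub_cancel, ← mul_prod_erase univ _ (mem_univ j),
    ← mul_prod_erase univ _ (mem_univ j)]
  have : ∏ i ∈ univ.erase j, s i ^ (m + Finsupp.single j 1 : Fin q →₀ ℕ) i /
        ((m + Finsupp.single j 1 : Fin q →₀ ℕ) i)! = ∏ i ∈ univ.erase j, s i ^ m i / (m i)! := by
    refine prod_congr rfl fun i hi => ?_
    simp [Finsupp.single_eq_of_ne (ne_of_mem_erase hi)]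
  rw [this]
  simp only [Finsupp.add_apply, Finsupp.single_eq_same, Nat.factorial_succ, pow_succ]
  push_cast
  have h1 : ((m j)! : ℝ) ≠ 0 := by positivity
  have h2 : (m j : ℝ) + 1 ≠ 0 := by positivity
  field_simp

lemma eulerOp_expSeries_pow (x : ℝ) (s : Fin q → ℝ) :
    eulerOp (expSeries (fun d => x ^ d) s) =
      linForm (fun j => x * s j) * expSeries (fun d => x ^ d) s := by
  have hlin : linForm (fun j => x * s j) = C x * linForm s := by
    simp only [linForm, mul_sum]
    refine sum_congr rfl fun j _ => ?_
    ext m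
    simp [coeff_monomial]
  ext m
  rw [hlin, mul_assoc, coeff_C_mul, coeff_linForm_mul_expSeries, coeff_eulerOp, coeff_expSeries]
  rcases Nat.eq_zero_or_pos m.degree with h | h
  · simp [h]
  · rw [← Nat.sub_add_cancel h, Nat.add_sub_cancel, pow_succ]
    ring

/-- The multinomial theorem for several linear forms at once. -/
lemma coeff_prod_expSeries_pow {ι : Type*} [Fintype ι] (x : ι → ℝ) (S : ι → Fin q → ℝ)
    (m : Fin q →₀ ℕ) :
    coeff m (∏ i, expSeries (fun d => x i ^ d) (S i)) =
      ∏ j, (∑ i, S i j * x i) ^ m j / (m j)! := by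
  have h : ∏ i, expSeries (fun d => x i ^ d) (S i) =
      expSeries (fun d => 1 ^ d) (fun j => ∑ i, S i j * x i) := by
    refine eq_of_eulerOp_eq (H := ∑ i, linForm (fun j => x i * S i j)) ?_
      (eulerOp_prod _ _ _ fun i _ => eulerOp_expSeries_pow _ _) ?_ ?_
    · simp [coeff_zero_linForm]
    · rw [eulerOp_expSeries_pow]
      congr 1
      simp only [linForm]
      rw [sum_comm]
      refine sum_congr rfl fun j _ => ?_
      rw [← map_sum]
      simp [mul_comm]
    · rw [coeff_zero_eq_constantCoeff, map_prod]
      simp [← coeff_zero_eq_constantCoeff_apply, coeff_expSeries]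
  rw [h, coeff_expSeries]
  simp

/-- The binomial series `(1 - ∑ⱼ sⱼ Xⱼ)^(-a)`. -/
noncomputable def negBinomialSeries (a : ℝ) (s : Fin q → ℝ) : MvPowerSeries (Fin q) ℝ :=
  expSeries (fun d => (ascPochhammer ℝ d).eval a) s

lemma coeff_zero_negBinomialSeries (a : ℝ) (s : Fin q → ℝ) :
    coeff 0 (negBinomialSeries a s) = 1 := by
  simp [negBinomialSeries, coeff_expSeries]

lemma one_sub_linForm_mul_negBinomialSeries_one (s : Fin q → ℝ) :
    (1 - linForm s) * negBinomialSeries 1 s = 1 := by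
  ext m
  rw [sub_mul, one_mul, map_sub, negBinomialSeries, coeff_linForm_mul_expSeries, coeff_expSeries,
    coeff_one]
  by_cases hm : m = 0
  · simp [hm]
  have hd : m.degree ≠ 0 := by simpa [Finsupp.degree_eq_zero_iff] using hm
  obtain ⟨d, hd⟩ := Nat.exists_eq_succ_of_ne_zero hd
  simp only [hd, if_neg hm, ascPochhammer_eval_one, Nat.succ_sub_one, Nat.factorial_succ,
    Nat.succ_eq_add_one]
  push_cast
  ring

lemma eulerOp_negBinomialSeries (a : ℝ) (s : Fin q → ℝ) :
    eulerOp (negBinomialSeries a s) =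
      (C a * (negBinomialSeries 1 s - 1)) * negBinomialSeries a s := by
  have h : (1 - linForm s) * eulerOp (negBinomialSeries a s) =
      C a * (linForm s * negBinomialSeries a s) := by
    have he : eulerOp (negBinomialSeries a s) =
        expSeries (fun d => d * (ascPochhammer ℝ d).eval a) s := by
      ext m
      rw [coeff_eulerOp, negBinomialSeries, coeff_expSeries, coeff_expSeries, mul_assoc]
    ext m
    rw [sub_mul, one_mul, map_sub, coeff_C_mul, he, negBinomialSeries,
      coeff_linForm_mul_expSeries, coeff_linForm_mul_expSeries, coeff_expSeries]
    rcases Nat.eq_zero_or_pos m.degree with h | h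
    · simp [h]
    · obtain ⟨d, hd⟩ := Nat.exists_eq_succ_of_ne_zero h.ne'
      simp only [hd, Nat.succ_sub_one, Nat.succ_eq_add_one, ascPochhammer_succ_eval]
      push_cast
      ring
  have hu := one_sub_linForm_mul_negBinomialSeries_one s
  linear_combination (negBinomialSeries 1 s) * h -
    (eulerOp (negBinomialSeries a s) + C a * negBinomialSeries a s) * hu
lemma colA_add_single (B : (Fin q → ℕ) →₀ ℕ) (a : Fin q → ℕ) :
    colA (B + Finsupp.single a 1) = colA B + a := by
  funext j
  change (B + Finsupp.single a 1).sum (fun a k => k * a j) = B.sum (fun a k => k * a j) + a j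
  rw [Finsupp.sum_add_index' (by simp) (by intros; ring), Finsupp.sum_single_index (by simp),
    one_mul]

lemma mul_le_colA (A : (Fin q → ℕ) →₀ ℕ) (a : Fin q → ℕ) (j : Fin q) :
    A a * a j ≤ colA A j := by
  by_cases ha : a ∈ A.support
  · exact single_le_sum (f := fun a => A a * a j) (fun _ _ => Nat.zero_le _) ha
  · simp [Finsupp.notMem_support_iff.1 ha]

lemma finite_CPartSet (n : Fin q → ℕ) : (CPartSet n).Finite := by
  have hfin : {A : (Fin q → ℕ) →₀ ℕ | A.support ⊆ Finset.Iic n ∧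
      ∀ a ∈ Finset.Iic n, A a ≤ ∑ j, n j}.Finite := by
    refine ((Finset.Iic n).finsupp fun _ => Finset.Iic (∑ j, n j)).finite_toSet.subset ?_
    intro A hA
    rw [mem_coe, Finset.mem_finsupp_iff]
    exact ⟨hA.1, fun a ha => Finset.mem_Iic.2 (hA.2 a ha)⟩
  refine hfin.subset ?_
  rintro A ⟨h0, rfl⟩
  refine ⟨fun a ha => Finset.mem_Iic.2 fun j => ?_, fun a _ => ?_⟩
  · have := mul_le_colA A a j
    have h1 : 1 ≤ A a := Nat.one_le_iff_ne_zero.2 (Finsupp.mem_support_iff.1 ha)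
    exact (Nat.le_mul_of_pos_left _ h1).trans this
  · by_cases ha : a = 0
    · simp [ha, h0]
    obtain ⟨j, hj⟩ := Function.ne_iff.1 ha
    have hj' : 1 ≤ a j := Nat.one_le_iff_ne_zero.2 hj
    calc A a ≤ A a * a j := Nat.le_mul_of_pos_right _ hj'
      _ ≤ colA A j := mul_le_colA A a j
      _ ≤ ∑ j, colA A j := single_le_sum (fun _ _ => Nat.zero_le _) (mem_univ j)

/-- The weight `∏_a p_a^{A(a)} / A(a)!` of a colored partition. -/
noncomputable def partWeight (p : (Fin q → ℕ) → ℝ) (A : (Fin q → ℕ) →₀ ℕ) : ℝ :=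
  A.prod fun a k => p a ^ k / k !

lemma partWeight_add_single (p : (Fin q → ℕ) → ℝ) (B : (Fin q → ℕ) →₀ ℕ) (a : Fin q → ℕ) :
    ((B + Finsupp.single a 1 : (Fin q → ℕ) →₀ ℕ) a : ℝ) * partWeight p (B + Finsupp.single a 1) =
      p a * partWeight p B := by
  have herase : (B + Finsupp.single a 1).erase a = B.erase a := by
    simp [Finsupp.erase_add]
  rw [partWeight, partWeight, ← Finsupp.mul_prod_erase' _ a _ (by simp),
    ← Finsupp.mul_prod_erase' B a _ (by simp), herase]
  simp only [Finsupp.add_apply, Finsupp.single_eq_same, Nat.factorial_succ, pow_succ]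
  push_cast
  have h1 : ((B a)! : ℝ) ≠ 0 := by positivity
  have h2 : (B a : ℝ) + 1 ≠ 0 := by positivity
  field_simp

/-- The exponential of `∑_a p_a X^a`. -/
noncomputable def partSeries (p : (Fin q → ℕ) → ℝ) : MvPowerSeries (Fin q) ℝ :=
  fun m => ∑ A ∈ (finite_CPartSet m).toFinset, partWeight p A

lemma coeff_partSeries (p : (Fin q → ℕ) → ℝ) (m : Fin q →₀ ℕ) :
    coeff m (partSeries p) = ∑ A ∈ (finite_CPartSet m).toFinset, partWeight p A := rfl

lemma coeff_zero_partSeries (p : (Fin q → ℕ) → ℝ) : coeff 0 (partSeries p) = 1 := by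
  have : (finite_CPartSet (⇑(0 : Fin q →₀ ℕ))).toFinset = {0} := by
    ext A
    rw [Set.Finite.mem_toFinset, mem_singleton]
    constructor
    · rintro ⟨h0, h⟩
      ext a
      by_cases ha : a = 0
      · simp [ha, h0]
      obtain ⟨j, hj⟩ := Function.ne_iff.1 ha
      have := mul_le_colA A a j
      rw [h] at this
      simpa [show a j ≠ 0 from hj] using this
    · rintro rfl
      exact ⟨rfl, funext fun j => by simp [colA]⟩
  rw [coeff_partSeries, this, sum_singleton]
  simp [partWeight]

lemma eulerOp_partSeries (p : (Fin q → ℕ) → ℝ) :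
    eulerOp (partSeries p) =
      (show MvPowerSeries (Fin q) ℝ from fun m => (m.degree : ℝ) * p m) * partSeries p := by
  ext m
  rw [coeff_mul, coeff_eulerOp, coeff_partSeries, mul_sum]
  have hL : ∀ A ∈ (finite_CPartSet m).toFinset, (m.degree : ℝ) * partWeight p A =
      ∑ a ∈ A.support, (∑ j, (a j : ℝ)) * (A a * partWeight p A) := by
    intro A hA
    obtain ⟨-, hcol⟩ := (Set.Finite.mem_toFinset _).1 hA
    rw [Finsupp.degree_eq_sum, ← hcol]
    simp only [colA]
    push_cast
    rw [sum_comm, sum_mul]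
    refine sum_congr rfl fun a _ => ?_
    rw [← mul_sum]
    ring
  have hR : ∑ x ∈ antidiagonal m, coeff x.1
        (show MvPowerSeries (Fin q) ℝ from fun m => (m.degree : ℝ) * p m) *
          coeff x.2 (partSeries p) =
      ∑ x ∈ antidiagonal m with x.1 ≠ 0, ∑ B ∈ (finite_CPartSet x.2).toFinset,
        (∑ j, (x.1 j : ℝ)) * (p x.1 * partWeight p B) := by
    rw [sum_filter]
    refine sum_congr rfl fun x _ => ?_
    rw [coeff_partSeries, show coeff x.1
        (show MvPowerSeries (Fin q) ℝ from fun m => (m.degree : ℝ) * p m) =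
          (x.1.degree : ℝ) * p x.1 from rfl]
    split_ifs with h
    · rw [Finsupp.degree_eq_sum, mul_sum]
      push_cast
      exact sum_congr rfl fun B _ => by ring
    · rw [not_not] at h
      simp [h]
  rw [sum_congr rfl hL, hR, sum_sigma', sum_sigma']
  symm
  refine sum_bij' (fun x _ => ⟨x.2 + Finsupp.single (⇑x.1.1) 1, ⇑x.1.1⟩)
    (fun y _ => ⟨(Finsupp.equivFunOnFinite.symm y.2,
      m - Finsupp.equivFunOnFinite.symm y.2), y.1 - Finsupp.single y.2 1⟩) ?_ ?_ ?_ ?_ ?_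
  · rintro ⟨⟨a, b⟩, B⟩ h
    simp only [mem_sigma, mem_filter, HasAntidiagonal.mem_antidiagonal,
      Set.Finite.mem_toFinset] at h ⊢
    obtain ⟨⟨hab, ha⟩, hB0, hB⟩ := h
    refine ⟨⟨?_, ?_⟩, ?_⟩
    · have : (⇑a : Fin q → ℕ) ≠ 0 := fun h => ha (DFunLike.coe_injective h)
      simp [hB0, this]
    · rw [colA_add_single, hB, ← hab, add_comm]
      rfl
    · simp
  · rintro ⟨A, a⟩ h
    simp only [mem_sigma, mem_filter, HasAntidiagonal.mem_antidiagonal,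
      Set.Finite.mem_toFinset] at h ⊢
    obtain ⟨⟨hA0, hA⟩, ha⟩ := h
    have ha1 : Finsupp.single a 1 ≤ A := by
      rw [Finsupp.single_le_iff]
      exact Nat.one_le_iff_ne_zero.2 (Finsupp.mem_support_iff.1 ha)
    obtain ⟨B, rfl⟩ : ∃ B, A = B + Finsupp.single a 1 := ⟨_, (tsub_add_cancel_of_le ha1).symm⟩
    rw [colA_add_single] at hA
    refine ⟨⟨?_, ?_⟩, ?_, ?_⟩
    · refine add_tsub_cancel_of_le (Finsupp.le_def.2 fun j => ?_)
      have := congrFun hA j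
      simp only [Pi.add_apply] at this
      simp only [Finsupp.equivFunOnFinite_symm_apply_apply]
      omega
    · intro h
      have h' : a = 0 := by
        funext j
        simpa using DFunLike.congr_fun h j
      simp [h'] at hA0
    · simp only [Finsupp.add_apply, Nat.add_eq_zero_iff] at hA0
      simp [hA0.1]
    · rw [add_tsub_cancel_right]
      funext j
      have := congrFun hA j
      simp only [Pi.add_apply] at this
      simp only [Finsupp.tsub_apply, Finsupp.equivFunOnFinite_symm_apply_apply]
      omega
  · rintro ⟨⟨a, b⟩, B⟩ h
    simp only [mem_sigma, mem_filter, HasAntidiagonal.mem_antidiagonal] at h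
    obtain ⟨⟨rfl, -⟩, -⟩ := h
    have : Finsupp.equivFunOnFinite.symm ⇑a = a := Finsupp.equivFunOnFinite.symm_apply_apply a
    simp [this]
  · rintro ⟨A, a⟩ h
    simp only [mem_sigma] at h
    have ha1 : Finsupp.single a 1 ≤ A := by
      rw [Finsupp.single_le_iff]
      exact Nat.one_le_iff_ne_zero.2 (Finsupp.mem_support_iff.1 h.2)
    simp [tsub_add_cancel_of_le ha1]
  · rintro ⟨⟨a, b⟩, B⟩ h
    simp only
    rw [partWeight_add_single]

lemma Zpoly_eq_coeff_partSeries (m : Fin q →₀ ℕ) (t : (Fin q → ℕ) → ℝ) :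
    Zpoly m t = coeff m (partSeries fun a =>
      (Nat.multinomial univ a : ℝ) / (∑ j, (a j : ℝ)) * t a) := by
  have hn : (∏ j, ((m j)! : ℝ)) ≠ 0 := by positivity
  rw [Zpoly, finsum_mem_eq_finite_toFinset_sum _ (finite_CPartSet m), coeff_partSeries, mul_sum]
  refine sum_congr rfl fun A _ => ?_
  rw [Mcoef, mul_assoc, inv_mul_cancel_left₀ hn, ← prod_mul_distrib, partWeight, Finsupp.prod]
  refine prod_congr rfl fun a _ => ?_
  rw [mul_pow, div_pow, div_mul_eq_mul_div, div_mul_eq_mul_div, div_div]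

/-- The cycle index polynomial at `Ω[S;α]` is a coefficient of `∏ᵢ (1 - ∑ⱼ Sᵢⱼ Xⱼ)^(-αᵢ)`. -/
lemma Zpoly_eq_coeff_prod {ι : Type*} [Fintype ι] (α : ι → ℝ) (S : ι → Fin q → ℝ)
    (m : Fin q →₀ ℕ) :
    Zpoly m (fun a => ∑ i, (∏ j, S i j ^ a j) * α i) =
      coeff m (∏ i, negBinomialSeries (α i) (S i)) := by
  rw [Zpoly_eq_coeff_partSeries]
  congr 1
  refine eq_of_eulerOp_eq (H := ∑ i, C (α i) * (negBinomialSeries 1 (S i) - 1)) ?_ ?_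
    (eulerOp_prod _ _ _ fun i _ => eulerOp_negBinomialSeries _ _) ?_
  · rw [map_sum]
    refine sum_eq_zero fun i _ => ?_
    rw [coeff_C_mul, map_sub, coeff_zero_negBinomialSeries]
    simp
  · rw [eulerOp_partSeries]
    congr 1
    ext m
    change (m.degree : ℝ) * _ = _
    rw [map_sum]
    by_cases hm : m = 0
    · subst hm
      simp [coeff_C_mul, coeff_zero_negBinomialSeries, coeff_zero_one,
        -coeff_zero_eq_constantCoeff]
    have hd : (m.degree : ℝ) ≠ 0 := by simpa [Finsupp.degree_eq_zero_iff] using hm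
    have hdeg : (m.degree : ℝ) = ∑ j, (m j : ℝ) := by
      rw [Finsupp.degree_eq_sum]
      push_cast
      rfl
    have hmult : (Nat.multinomial univ ⇑m : ℝ) = (m.degree)! / ∏ j, ((m j)! : ℝ) := by
      rw [eq_div_iff (by positivity), Finsupp.degree_eq_sum, ← Nat.multinomial_spec univ ⇑m]
      push_cast
      ring
    rw [← hdeg, ← mul_assoc, mul_div_cancel₀ _ hd, hmult, mul_sum]
    refine sum_congr rfl fun i _ => ?_
    rw [coeff_C_mul, map_sub, coeff_one, if_neg hm, negBinomialSeries, coeff_expSeries,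
      ascPochhammer_eval_one, prod_div_distrib]
    ring
  · rw [coeff_zero_partSeries, coeff_zero_eq_constantCoeff, map_prod]
    simp [← coeff_zero_eq_constantCoeff_apply, coeff_zero_negBinomialSeries,
      -coeff_zero_eq_constantCoeff]

end PowerSeriesIdentities

section DirichletIntegral

lemma lintegral_beta_scaled {a b T : ℝ} (ha : 0 < a) (hb : 0 < b) (hT : 0 < T) :
    ∫⁻ x, (Set.Ioo 0 T).indicator
        (fun x => ENNReal.ofReal (x ^ (a - 1) * (T - x) ^ (b - 1))) x =
      ENNReal.ofReal (T ^ (a + b - 1) * (Real.Gamma a * Real.Gamma b / Real.Gamma (a + b))) := by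
  have hB := ProbabilityTheory.beta_pos ha hb
  have h1 : ∫⁻ x in Set.Ioo (0 : ℝ) 1, ENNReal.ofReal (x ^ (a - 1) * (1 - x) ^ (b - 1)) =
      ENNReal.ofReal (ProbabilityTheory.beta a b) := by
    have h := ProbabilityTheory.lintegral_betaPDF_eq_one ha hb
    rw [ProbabilityTheory.lintegral_betaPDF] at h
    simp_rw [mul_assoc, ENNReal.ofReal_mul (one_div_pos.2 hB).le] at h
    rw [lintegral_const_mul _ (by fun_prop)] at h
    calc _ = ENNReal.ofReal (ProbabilityTheory.beta a b) *
          (ENNReal.ofReal (1 / ProbabilityTheory.beta a b) *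
          ∫⁻ x in Set.Ioo (0 : ℝ) 1, ENNReal.ofReal (x ^ (a - 1) * (1 - x) ^ (b - 1))) := by
          rw [← mul_assoc, ← ENNReal.ofReal_mul hB.le, mul_one_div_cancel hB.ne',
            ENNReal.ofReal_one, one_mul]
      _ = _ := by rw [h, mul_one]
  have hmeas : Measurable ((Set.Ioo 0 T).indicator
      (fun x => ENNReal.ofReal (x ^ (a - 1) * (T - x) ^ (b - 1)))) :=
    Measurable.indicator (by fun_prop) measurableSet_Ioo
  rw [← Real.smul_map_volume_mul_left hT.ne', lintegral_smul_measure,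
    lintegral_map hmeas (by fun_prop)]
  have h2 : ∀ u : ℝ, (Set.Ioo 0 T).indicator
      (fun x => ENNReal.ofReal (x ^ (a - 1) * (T - x) ^ (b - 1))) (T * u) =
      ENNReal.ofReal (T ^ (a + b - 2)) * (Set.Ioo 0 1).indicator
        (fun x => ENNReal.ofReal (x ^ (a - 1) * (1 - x) ^ (b - 1))) u := by
    intro u
    have hmem : T * u ∈ Set.Ioo 0 T ↔ u ∈ Set.Ioo (0 : ℝ) 1 := by
      simp [Set.mem_Ioo, hT]
    by_cases hu : u ∈ Set.Ioo (0 : ℝ) 1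
    · rw [Set.indicator_of_mem (hmem.2 hu), Set.indicator_of_mem hu,
        ← ENNReal.ofReal_mul (by positivity)]
      congr 1
      rw [show T - T * u = T * (1 - u) by ring, Real.mul_rpow hT.le hu.1.le,
        Real.mul_rpow hT.le (by linarith [hu.2]),
        show a + b - 2 = (a - 1) + (b - 1) by ring, Real.rpow_add hT]
      ring
    · rw [Set.indicator_of_notMem (mt hmem.1 hu), Set.indicator_of_notMem hu, mul_zero]
  simp_rw [h2]
  rw [lintegral_const_mul _ (Measurable.indicator (by fun_prop) measurableSet_Ioo),
    lintegral_indicator measurableSet_Ioo, h1, smul_eq_mul, abs_of_pos hT,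
    ← ENNReal.ofReal_mul (by positivity), ← ENNReal.ofReal_mul hT.le, ProbabilityTheory.beta,
    show a + b - 1 = 1 + (a + b - 2) by ring, Real.rpow_add hT, Real.rpow_one, mul_assoc]

/-- The simplex `{y ≥ 0, ∑ y ≤ T}`. -/
def solidSimplex (k : ℕ) (T : ℝ) : Set (Fin k → ℝ) :=
  {y | (∀ i, 0 ≤ y i) ∧ ∑ i, y i ≤ T}

lemma measurableSet_solidSimplex (k : ℕ) (T : ℝ) : MeasurableSet (solidSimplex k T) := by
  have h : solidSimplex k T = (⋂ i, {y | 0 ≤ y i}) ∩ {y | ∑ i, y i ≤ T} := by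
    ext y
    simp [solidSimplex]
  rw [h]
  refine (MeasurableSet.iInter fun i => ?_).inter ?_
  · exact measurableSet_le measurable_const (measurable_pi_apply i)
  · exact measurableSet_le (by fun_prop) measurable_const

/-- The unnormalized Dirichlet density on the simplex `{y ≥ 0, ∑ y ≤ T}`. -/
noncomputable def dirKernel {k : ℕ} (β : Fin (k + 1) → ℝ) (T : ℝ) (y : Fin k → ℝ) : ℝ :=
  (∏ i, y i ^ (β (Fin.castSucc i) - 1)) * (T - ∑ i, y i) ^ (β (Fin.last k) - 1)

lemma measurable_dirKernel {k : ℕ} (β : Fin (k + 1) → ℝ) (T : ℝ) :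
    Measurable (dirKernel β T) := by
  unfold dirKernel
  fun_prop

lemma dirKernel_nonneg {k : ℕ} (β : Fin (k + 1) → ℝ) (T : ℝ) {y : Fin k → ℝ}
    (hy : y ∈ solidSimplex k T) : 0 ≤ dirKernel β T y :=
  mul_nonneg (prod_nonneg fun i _ => Real.rpow_nonneg (hy.1 i) _)
    (Real.rpow_nonneg (sub_nonneg.2 hy.2) _)

lemma multiBeta_pos {k : ℕ} {β : Fin (k + 1) → ℝ} (hβ : ∀ i, 0 < β i) : 0 < multiBeta β :=
  div_pos (prod_pos fun i _ => Real.Gamma_pos_of_pos (hβ i))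
    (Real.Gamma_pos_of_pos (sum_pos (fun i _ => hβ i) univ_nonempty))

lemma indicator_dirKernel_cons {k : ℕ} (β : Fin (k + 2) → ℝ) {T x : ℝ} (hx : 0 < x)
    (y : Fin k → ℝ) :
    (solidSimplex (k + 1) T).indicator (fun y => ENNReal.ofReal (dirKernel β T y))
        (Fin.cons x y : Fin (k + 1) → ℝ) =
      ENNReal.ofReal (x ^ (β 0 - 1)) * (solidSimplex k (T - x)).indicator
        (fun y => ENNReal.ofReal (dirKernel (fun i => β i.succ) (T - x) y)) y := by
  have hmem : (Fin.cons x y : Fin (k + 1) → ℝ) ∈ solidSimplex (k + 1) T ↔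
      y ∈ solidSimplex k (T - x) := by
    simp only [solidSimplex, Set.mem_ofPred_eq, Fin.forall_fin_succ, Fin.cons_zero, Fin.cons_succ,
      Fin.sum_univ_succ, hx.le, true_and, le_sub_iff_add_le']
  by_cases hy : y ∈ solidSimplex k (T - x)
  · rw [Set.indicator_of_mem (hmem.2 hy), Set.indicator_of_mem hy,
      ← ENNReal.ofReal_mul (Real.rpow_nonneg hx.le _)]
    congr 1
    simp only [dirKernel, Fin.prod_univ_succ, Fin.sum_univ_succ, Fin.cons_zero, Fin.cons_succ,
      Fin.castSucc_zero, ← Fin.succ_castSucc, Fin.succ_last, sub_sub, mul_assoc]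
  · rw [Set.indicator_of_notMem (mt hmem.1 hy), Set.indicator_of_notMem hy, mul_zero]

/-- Dirichlet's integral. -/
lemma lintegral_dirKernel {k : ℕ} (β : Fin (k + 1) → ℝ) (hβ : ∀ i, 0 < β i) {T : ℝ}
    (hT : 0 < T) :
    ∫⁻ y, (solidSimplex k T).indicator (fun y => ENNReal.ofReal (dirKernel β T y)) y =
      ENNReal.ofReal (T ^ (∑ i, β i - 1) * multiBeta β) := by
  induction k generalizing T with
  | zero =>
    have hΓ : Real.Gamma (β 0) ≠ 0 := (Real.Gamma_pos_of_pos (hβ 0)).ne'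
    rw [volume_pi, Measure.pi_of_empty, lintegral_dirac, Set.indicator_of_mem]
    · simp [dirKernel, multiBeta, hΓ]
    · simp [solidSimplex, hT.le]
  | succ k ih =>
    set b := ∑ i : Fin (k + 1), β i.succ with hb
    have hβ' : ∀ i : Fin (k + 1), 0 < β i.succ := fun i => hβ _
    have hb0 : 0 < b := sum_pos (fun i _ => hβ' i) univ_nonempty
    have hmeas : ∀ {k : ℕ} (β : Fin (k + 1) → ℝ) (T : ℝ), Measurable
        ((solidSimplex k T).indicator (fun y => ENNReal.ofReal (dirKernel β T y))) := fun β T =>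
      (measurable_dirKernel β T).ennreal_ofReal.indicator (measurableSet_solidSimplex _ _)
    have hmp := (volume_preserving_piFinSuccAbove (fun _ : Fin (k + 1) => ℝ) 0).symm
    rw [← hmp.lintegral_comp (hmeas β T), Measure.volume_eq_prod,
      lintegral_prod _ (by exact ((hmeas β T).comp hmp.measurable).aemeasurable)]
    have hae : ∀ᵐ x : ℝ, ∫⁻ y : Fin k → ℝ, (solidSimplex (k + 1) T).indicator
          (fun y => ENNReal.ofReal (dirKernel β T y))
          ((MeasurableEquiv.piFinSuccAbove (fun _ : Fin (k + 1) => ℝ) 0).symm (x, y)) =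
        (Set.Ioo 0 T).indicator
          (fun x => ENNReal.ofReal (x ^ (β 0 - 1) * (T - x) ^ (b - 1))) x *
          ENNReal.ofReal (multiBeta fun i => β i.succ) := by
      filter_upwards [Measure.ae_ne volume (0 : ℝ), Measure.ae_ne volume T] with x hx0 hxT
      have hcons : ∀ y : Fin k → ℝ,
          (MeasurableEquiv.piFinSuccAbove (fun _ : Fin (k + 1) => ℝ) 0).symm (x, y) =
            (Fin.cons x y : Fin (k + 1) → ℝ) := fun y => by
        simp [MeasurableEquiv.piFinSuccAbove, Fin.insertNthEquiv]
      simp_rw [hcons]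
      by_cases hx : x ∈ Set.Ioo 0 T
      · rw [Set.indicator_of_mem hx]
        simp_rw [indicator_dirKernel_cons β hx.1]
        have hxp : 0 ≤ x ^ (β 0 - 1) := Real.rpow_nonneg hx.1.le _
        have hTp : 0 ≤ (T - x) ^ (b - 1) := Real.rpow_nonneg (by linarith [hx.2]) _
        rw [lintegral_const_mul _ (hmeas _ _), ih _ hβ' (sub_pos.2 hx.2), ← ENNReal.ofReal_mul hxp,
          ← ENNReal.ofReal_mul (mul_nonneg hxp hTp), mul_assoc]
      · rw [Set.indicator_of_notMem hx, zero_mul]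
        refine (lintegral_congr fun y => Set.indicator_of_notMem ?_ _).trans lintegral_zero
        rintro ⟨h0, h1⟩
        rw [Fin.sum_univ_succ] at h1
        have hx' := h0 0
        have hs : 0 ≤ ∑ i, y i := sum_nonneg fun i _ => by simpa using h0 i.succ
        simp only [Fin.cons_zero, Fin.cons_succ] at h1 hx'
        exact hx ⟨lt_of_le_of_ne hx' (Ne.symm hx0), lt_of_le_of_ne (by linarith) hxT⟩
    rw [lintegral_congr_ae hae, lintegral_mul_const _
      (Measurable.indicator (by fun_prop) measurableSet_Ioo), lintegral_beta_scaled (hβ 0) hb0 hT]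
    have hΓ : ∀ {x : ℝ}, 0 < x → 0 < Real.Gamma x := Real.Gamma_pos_of_pos
    have hΓ0 := hΓ (hβ 0)
    have hΓb := hΓ hb0
    have hΓs := hΓ (add_pos (hβ 0) hb0)
    rw [← ENNReal.ofReal_mul (by positivity), Fin.sum_univ_succ, ← hb]
    congr 1
    rw [multiBeta, multiBeta, ← hb, Fin.prod_univ_succ (fun i => Real.Gamma (β i)),
      Fin.sum_univ_succ β, ← hb]
    field_simp

lemma integrableOn_dirKernel {k : ℕ} {β : Fin (k + 1) → ℝ} (hβ : ∀ i, 0 < β i) :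
    IntegrableOn (dirKernel β 1) (solidSimplex k 1) := by
  have hmeas := measurableSet_solidSimplex k 1
  refine (lintegral_ofReal_ne_top_iff_integrable
    (measurable_dirKernel β 1).aestronglyMeasurable
    (ae_restrict_of_forall_mem hmeas fun y hy => dirKernel_nonneg β 1 hy)).1 ?_
  rw [← lintegral_indicator hmeas, lintegral_dirKernel β hβ one_pos]
  exact ENNReal.ofReal_ne_top

lemma setIntegral_dirKernel {k : ℕ} {β : Fin (k + 1) → ℝ} (hβ : ∀ i, 0 < β i) :
    ∫ y in solidSimplex k 1, dirKernel β 1 y = multiBeta β := by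
  have hmeas := measurableSet_solidSimplex k 1
  rw [integral_eq_lintegral_of_nonneg_ae
    (ae_restrict_of_forall_mem hmeas fun y hy => dirKernel_nonneg β 1 hy)
    (measurable_dirKernel β 1).aestronglyMeasurable,
    ← lintegral_indicator hmeas, lintegral_dirKernel β hβ one_pos, Real.one_rpow, one_mul,
    ENNReal.toReal_ofReal (multiBeta_pos hβ).le]

lemma prod_snoc_pow_mul_dirKernel {k : ℕ} {α : Fin (k + 1) → ℝ} (hα : ∀ i, 0 < α i)
    (m : Fin (k + 1) → ℕ) {y : Fin k → ℝ} (hy : y ∈ solidSimplex k 1) :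
    (∏ i, (Fin.snoc y (1 - ∑ i, y i) : Fin (k + 1) → ℝ) i ^ m i) * dirKernel α 1 y =
      dirKernel (fun i => α i + m i) 1 y := by
  have hpow : ∀ (x : ℝ) (i : Fin (k + 1)), 0 ≤ x →
      x ^ (α i + m i - 1) = x ^ m i * x ^ (α i - 1) := by
    intro x i hx
    rcases Nat.eq_zero_or_pos (m i) with h | h
    · simp [h]
    · have h1 : (1 : ℝ) ≤ m i := by exact_mod_cast h
      have h2 := hα i
      rw [show α i + m i - 1 = (α i - 1) + m i by ring,
        Real.rpow_add_natCast' hx (by linarith : 0 < α i - 1 + m i).ne', mul_comm]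
  simp only [dirKernel, Fin.prod_univ_castSucc, Fin.snoc_castSucc, Fin.snoc_last]
  rw [hpow _ _ (sub_nonneg.2 hy.2), prod_congr rfl fun i _ => hpow _ (Fin.castSucc i) (hy.1 i),
    prod_mul_distrib]
  ring

lemma Gamma_add_natCast {a : ℝ} (ha : 0 < a) (m : ℕ) :
    Real.Gamma (a + m) = (ascPochhammer ℝ m).eval a * Real.Gamma a := by
  induction m with
  | zero => simp
  | succ m ih =>
    push_cast
    rw [← add_assoc, Real.Gamma_add_one (by positivity), ih, ascPochhammer_succ_eval]
    ring

lemma multiBeta_add_natCast {k : ℕ} {α : Fin (k + 1) → ℝ} (hα : ∀ i, 0 < α i)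
    (m : Fin (k + 1) → ℕ) :
    multiBeta (fun i => α i + m i) = (∏ i, (ascPochhammer ℝ (m i)).eval (α i)) /
      (ascPochhammer ℝ (∑ i, m i)).eval (∑ i, α i) * multiBeta α := by
  have hs : 0 < ∑ i, α i := sum_pos (fun i _ => hα i) univ_nonempty
  rw [multiBeta, multiBeta, sum_add_distrib, ← Nat.cast_sum, Gamma_add_natCast hs,
    prod_congr rfl fun i _ => Gamma_add_natCast (hα i) (m i), prod_mul_distrib, mul_div_mul_comm]

/-- Moments of the form `∑_l c_l x^{m_l}` of the Dirichlet distribution. -/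
lemma dirMoment_sum_monomial {k : ℕ} {α : Fin (k + 1) → ℝ} (hα : ∀ i, 0 < α i) {ι : Type*}
    (s : Finset ι) (c : ι → ℝ) (m : ι → Fin (k + 1) → ℕ) :
    dirMoment α (fun x => ∑ l ∈ s, c l * ∏ i, x i ^ m l i) =
      ∑ l ∈ s, c l * ((∏ i, (ascPochhammer ℝ (m l i)).eval (α i)) /
        (ascPochhammer ℝ (∑ i, m l i)).eval (∑ i, α i)) := by
  have hpos : ∀ (l : ι) (i : Fin (k + 1)), 0 < α i + m l i := fun l i =>
    add_pos_of_pos_of_nonneg (hα i) (Nat.cast_nonneg _)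
  have hint : ∫ y in solidSimplex k 1,
      (∑ l ∈ s, c l * ∏ i, (Fin.snoc y (1 - ∑ i, y i) : Fin (k + 1) → ℝ) i ^ m l i) *
        dirKernel α 1 y =
      ∑ l ∈ s, c l * multiBeta (fun i => α i + m l i) := by
    rw [setIntegral_congr_fun (g := fun y => ∑ l ∈ s, c l * dirKernel (fun i => α i + m l i) 1 y)
      (measurableSet_solidSimplex k 1), integral_finsetSum]
    · refine sum_congr rfl fun l _ => ?_
      rw [integral_const_mul, setIntegral_dirKernel (hpos l)]
    · exact fun l _ => (integrableOn_dirKernel (hpos l)).const_mul _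
    · intro y hy
      simp only [sum_mul]
      exact sum_congr rfl fun l _ => by rw [mul_assoc, prod_snoc_pow_mul_dirKernel hα _ hy]
  have hB := (multiBeta_pos hα).ne'
  change (∫ y in solidSimplex k 1,
      (∑ l ∈ s, c l * ∏ i, (Fin.snoc y (1 - ∑ i, y i) : Fin (k + 1) → ℝ) i ^ m l i) *
        dirKernel α 1 y) / multiBeta α = _
  rw [hint, sum_div]
  refine sum_congr rfl fun l _ => ?_
  rw [multiBeta_add_natCast hα, ← mul_assoc, mul_div_cancel_right₀ _ hB]

end DirichletIntegral

/-- **Theorem 1 (multivariate moments of the Dirichlet distribution).**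
For `k,q ≥ 1`, `𝐧 ∈ ℕ^q`, `α ∈ ℝ₊^k` and a real `k×q` matrix `S` with columns `s₁,…,s_q`,
`∫ ∏_j (s_j·x)^{n_j} dDir_α(x) = 𝐧!/(|α|)_{|𝐧|} · Z_𝐧(Ω_𝐧[S;α])`, where
`Ω_𝐧[S;α]_𝐚 = ∑_i s_{i1}^{a₁}⋯s_{iq}^{a_q} α_i`. -/
theorem dirichlet_multivariate_moment (k q : ℕ) (hq : 1 ≤ q) (n : Fin q → ℕ)
    (α : Fin (k + 1) → ℝ) (hα : ∀ i, 0 < α i) (S : Matrix (Fin (k + 1)) (Fin q) ℝ) :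
    dirMoment α (fun x => ∏ j, (∑ i, S i j * x i) ^ n j) =
      (∏ j, (n j)! : ℝ) / (ascPochhammer ℝ (∑ j, n j)).eval (∑ i, α i) *
        Zpoly n (fun a => ∑ i, (∏ j, S i j ^ a j) * α i) := by
  have hfun : (fun x : Fin (k + 1) → ℝ => ∏ j, (∑ i, S i j * x i) ^ n j) = fun x =>
      ∑ l ∈ finsuppAntidiag univ (Finsupp.equivFunOnFinite.symm n),
        ((∏ j, (n j)! : ℝ) * ∏ i, ∏ j, S i j ^ l i j / (l i j)!) *
          ∏ i, x i ^ (l i).degree := by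
    funext x
    have h := coeff_prod_expSeries_pow x S (Finsupp.equivFunOnFinite.symm n)
    have hn : (∏ j, ((n j)! : ℝ)) ≠ 0 := by positivity
    simp only [Finsupp.equivFunOnFinite_symm_apply_apply, prod_div_distrib] at h
    rw [eq_div_iff hn, MvPowerSeries.coeff_prod] at h
    rw [← h, sum_mul]
    refine sum_congr rfl fun l _ => ?_
    simp only [coeff_expSeries, prod_mul_distrib]
    ring
  rw [hfun, dirMoment_sum_monomial hα]
  have hZ := Zpoly_eq_coeff_prod α S (Finsupp.equivFunOnFinite.symm n)
  rw [Finsupp.coe_equivFunOnFinite_symm] at hZ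
  rw [hZ, MvPowerSeries.coeff_prod, mul_sum]
  refine sum_congr rfl fun l hl => ?_
  have hdeg : ∑ i, (l i).degree = ∑ j, n j := by
    rw [← map_sum, (mem_finsuppAntidiag.1 hl).1, Finsupp.degree_eq_sum]
    rfl
  simp only [negBinomialSeries, coeff_expSeries, prod_mul_distrib]
  rw [hdeg]
  ring
end

section
/- Let 𝐧 ∈ ℕ^q with an 𝐧-coloring c. For every q-colored partition A of 𝐧, the number of permutations π ∈ S_{|𝐧|} with Π(π) = A equals the multinomial coefficient M_𝐧(A) = 𝐧! ∏_{𝐚 ∈ supp A} ((|𝐚|!/(a₁!⋯a_q!))^{A(𝐚)} / (|𝐚|^{A(𝐚)} A(𝐚)!)). Equivalently, each G_𝐧-orbit G_𝐧.π ⊆ S_{|𝐧|} has cardinality M_𝐧(Π(π)). -/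
open Finset Nat
open scoped Classical

/-- `ε(κ) ∈ ℕ^q`: the color count of a set of elements under the coloring `c`. -/
def epsilonCount {N q : ℕ} (c : Fin N → Fin q) (s : Finset (Fin N)) : Fin q → ℕ :=
  fun j => (s.filter fun y => c y = j).card

/-- `Π(π)`: the `q`-colored partition of a permutation `π`, recording for each color count
`𝐚` the number of cycles of `π` (including fixed points) with color count `𝐚`. -/
noncomputable def Ppi {N q : ℕ} (c : Fin N → Fin q) (π : Equiv.Perm (Fin N)) :
    (Fin q → ℕ) →₀ ℕ :=
  (∑ κ ∈ π.cycleFactorsFinset, Finsupp.single (epsilonCount c κ.support) 1) +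
    ∑ y ∈ Finset.univ \ π.support, Finsupp.single (epsilonCount c {y}) 1

/-- `H_n`: bijections `h` of `S_n` preserving conjugacy classes with
`i ~_π j → i ~_{h(π)} j`. -/
def Hset (n : ℕ) : Set (Equiv.Perm (Equiv.Perm (Fin n))) :=
  {h | (∀ π, IsConj π (h π)) ∧
    ∀ (π : Equiv.Perm (Fin n)) (i j : Fin n), π.SameCycle i j → (h π).SameCycle i j}

/-- The set of cycles of `π`, fixed points included. -/
abbrev Cycles {N : ℕ} (π : Equiv.Perm (Fin N)) : Type :=
  Quotient (Equiv.Perm.SameCycle.setoid π)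

/-- The cycle of `π` through `x`. -/
def cycleThrough {N : ℕ} (π : Equiv.Perm (Fin N)) (x : Fin N) : Cycles π :=
  Quotient.mk _ x

theorem cycleThrough_eq_iff {N : ℕ} {π : Equiv.Perm (Fin N)} {x y : Fin N} :
    cycleThrough π x = cycleThrough π y ↔ π.SameCycle x y :=
  Quotient.eq (r := Equiv.Perm.SameCycle.setoid π)

theorem cycleThrough_surjective {N : ℕ} (π : Equiv.Perm (Fin N)) :
    Function.Surjective (cycleThrough π) :=
  Quotient.mk_surjective

/-- The elements of a cycle. -/
noncomputable def cycleElems {N : ℕ} (π : Equiv.Perm (Fin N)) (C : Cycles π) :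
    Finset (Fin N) :=
  Finset.univ.filter fun x => cycleThrough π x = C

/-- The color count of a cycle. -/
noncomputable def cycleColors {N q : ℕ} (c : Fin N → Fin q) (π : Equiv.Perm (Fin N))
    (C : Cycles π) : Fin q → ℕ :=
  epsilonCount c (cycleElems π C)

/-- The colored partition of `π`, as a sum over the quotient by `SameCycle`. -/
noncomputable def cyclePartition {N q : ℕ} (c : Fin N → Fin q) (π : Equiv.Perm (Fin N)) :
    (Fin q → ℕ) →₀ ℕ :=
  ∑ C : Cycles π, Finsupp.single (cycleColors c π C) 1

theorem mem_cycleElems {N : ℕ} {π : Equiv.Perm (Fin N)} {C : Cycles π} {x : Fin N} :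
    x ∈ cycleElems π C ↔ cycleThrough π x = C := by
  simp [cycleElems]

theorem mem_cycleElems_cycleThrough {N : ℕ} {π : Equiv.Perm (Fin N)} {x y : Fin N} :
    x ∈ cycleElems π (cycleThrough π y) ↔ π.SameCycle x y := by
  rw [mem_cycleElems, cycleThrough_eq_iff]

theorem cycleElems_injective {N : ℕ} (π : Equiv.Perm (Fin N)) :
    Function.Injective (cycleElems π) := by
  intro C D h
  obtain ⟨x, rfl⟩ := cycleThrough_surjective π C
  exact mem_cycleElems.1 (h ▸ mem_cycleElems.2 rfl)

theorem cycleElems_cycleThrough_of_mem_support {N : ℕ} {π : Equiv.Perm (Fin N)} {x : Fin N}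
    (hx : x ∈ π.support) : cycleElems π (cycleThrough π x) = (π.cycleOf x).support := by
  ext y
  rw [mem_cycleElems_cycleThrough, Equiv.Perm.mem_support_cycleOf_iff,
    Equiv.Perm.sameCycle_comm]
  exact ⟨fun h => ⟨h, hx⟩, fun h => h.1⟩

theorem cycleElems_cycleThrough_of_notMem_support {N : ℕ} {π : Equiv.Perm (Fin N)} {x : Fin N}
    (hx : x ∉ π.support) : cycleElems π (cycleThrough π x) = {x} := by
  ext y
  rw [mem_cycleElems_cycleThrough, Finset.mem_singleton]
  refine ⟨fun h => h.eq_of_right (Equiv.Perm.notMem_support.1 hx), fun h => h.sameCycle _⟩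

theorem support_injOn_cycleFactorsFinset {N : ℕ} (π : Equiv.Perm (Fin N)) :
    Set.InjOn Equiv.Perm.support (π.cycleFactorsFinset : Set (Equiv.Perm (Fin N))) := by
  intro κ hκ τ hτ h
  obtain ⟨x, hx⟩ := (Equiv.Perm.mem_cycleFactorsFinset_iff.1 hκ).1.nonempty_support
  have hx' : x ∈ τ.support := by simpa only [← h] using hx
  rw [(Equiv.Perm.eq_cycleOf_of_mem_cycleFactorsFinset_iff π κ hκ x).2 hx,
    (Equiv.Perm.eq_cycleOf_of_mem_cycleFactorsFinset_iff π τ hτ x).2 hx']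

theorem image_support_cycleFactorsFinset {N : ℕ} (π : Equiv.Perm (Fin N)) :
    π.cycleFactorsFinset.image Equiv.Perm.support =
      π.support.image fun x => cycleElems π (cycleThrough π x) := by
  ext s
  simp only [Finset.mem_image]
  constructor
  · rintro ⟨κ, hκ, rfl⟩
    obtain ⟨x, hx⟩ := (Equiv.Perm.mem_cycleFactorsFinset_iff.1 hκ).1.nonempty_support
    have hxπ := Equiv.Perm.mem_cycleFactorsFinset_support_le hκ hx
    refine ⟨x, hxπ, ?_⟩
    rw [cycleElems_cycleThrough_of_mem_support hxπ,
      ← (Equiv.Perm.eq_cycleOf_of_mem_cycleFactorsFinset_iff π κ hκ x).2 hx]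
  · rintro ⟨x, hx, rfl⟩
    exact ⟨π.cycleOf x, Equiv.Perm.cycleOf_mem_cycleFactorsFinset_iff.2 hx,
      (cycleElems_cycleThrough_of_mem_support hx).symm⟩

theorem image_cycleElems {N : ℕ} (π : Equiv.Perm (Fin N)) :
    Finset.univ.image (cycleElems π) =
      π.cycleFactorsFinset.image Equiv.Perm.support ∪
        (Finset.univ \ π.support).image fun y => {y} := by
  rw [image_support_cycleFactorsFinset]
  ext s
  simp only [Finset.mem_image, Finset.mem_union, Finset.mem_univ, true_and, Finset.mem_sdiff]
  constructor
  · rintro ⟨C, rfl⟩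
    obtain ⟨x, rfl⟩ := cycleThrough_surjective π C
    by_cases hx : x ∈ π.support
    · exact Or.inl ⟨x, hx, rfl⟩
    · exact Or.inr ⟨x, hx, (cycleElems_cycleThrough_of_notMem_support hx).symm⟩
  · rintro (⟨x, -, rfl⟩ | ⟨x, hx, rfl⟩)
    · exact ⟨cycleThrough π x, rfl⟩
    · exact ⟨cycleThrough π x, cycleElems_cycleThrough_of_notMem_support hx⟩

theorem Ppi_eq_cyclePartition {N q : ℕ} (c : Fin N → Fin q) (π : Equiv.Perm (Fin N)) :
    Ppi c π = cyclePartition c π := by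
  have himage : cyclePartition c π = ∑ s ∈ Finset.univ.image (cycleElems π),
      Finsupp.single (epsilonCount c s) 1 := by
    rw [Finset.sum_image (cycleElems_injective π).injOn]
    rfl
  rw [himage, image_cycleElems, Finset.sum_union, Finset.sum_image, Finset.sum_image, Ppi]
  · exact Finset.singleton_injective.injOn
  · exact support_injOn_cycleFactorsFinset π
  · rw [Finset.disjoint_left]
    intro s hs hs'
    simp only [Finset.mem_image, Finset.mem_sdiff, Finset.mem_univ, true_and] at hs hs'
    obtain ⟨κ, hκ, rfl⟩ := hs
    obtain ⟨x, hx, h⟩ := hs'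
    exact hx (Equiv.Perm.mem_cycleFactorsFinset_support_le hκ
      (h ▸ Finset.mem_singleton_self x))

theorem cyclePartition_apply {N q : ℕ} (c : Fin N → Fin q) (π : Equiv.Perm (Fin N))
    (a : Fin q → ℕ) :
    cyclePartition c π a = (Finset.univ.filter fun C => cycleColors c π C = a).card := by
  simp [cyclePartition, Finsupp.finsetSum_apply, Finsupp.single_apply]

theorem sum_cycleColors {N q : ℕ} (c : Fin N → Fin q) (π : Equiv.Perm (Fin N))
    (C : Cycles π) : ∑ j, cycleColors c π C j = (cycleElems π C).card :=
  (Finset.card_eq_sum_card_fiberwise (f := c) (s := cycleElems π C) (t := Finset.univ)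
    fun _ _ => Finset.mem_coe.2 (Finset.mem_univ _)).symm

theorem cycleColors_ne_zero {N q : ℕ} (c : Fin N → Fin q) (π : Equiv.Perm (Fin N))
    (C : Cycles π) : cycleColors c π C ≠ 0 := by
  intro h
  have hcard := sum_cycleColors c π C
  obtain ⟨x, rfl⟩ := cycleThrough_surjective π C
  rw [h] at hcard
  have : x ∈ cycleElems π (cycleThrough π x) := mem_cycleElems.2 rfl
  simp only [Pi.zero_apply, Finset.sum_const_zero] at hcard
  rw [Finset.card_eq_zero.1 hcard.symm] at this
  exact Finset.notMem_empty _ this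

theorem cyclePartition_zero {N q : ℕ} (c : Fin N → Fin q) (π : Equiv.Perm (Fin N)) :
    cyclePartition c π 0 = 0 := by
  rw [cyclePartition_apply, Finset.card_eq_zero, Finset.filter_eq_empty_iff]
  exact fun C _ => cycleColors_ne_zero c π C

theorem colA_add {q : ℕ} (A B : (Fin q → ℕ) →₀ ℕ) : colA (A + B) = colA A + colA B := by
  funext j
  exact Finsupp.sum_add_index' (h := fun (a : Fin q → ℕ) (k : ℕ) => k * a j) (by simp)
    (fun a k l => add_mul k l _)

theorem colA_zero {q : ℕ} : colA (0 : (Fin q → ℕ) →₀ ℕ) = 0 := by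
  funext j
  simp [colA]

theorem colA_single {q : ℕ} (a : Fin q → ℕ) : colA (Finsupp.single a 1) = a := by
  funext j
  exact (Finsupp.sum_single_index (h := fun (a : Fin q → ℕ) (k : ℕ) => k * a j) (by simp)).trans
    (one_mul _)

theorem colA_sum {q : ℕ} {ι : Type*} (s : Finset ι) (A : ι → (Fin q → ℕ) →₀ ℕ) :
    colA (∑ i ∈ s, A i) = ∑ i ∈ s, colA (A i) :=
  map_sum ({ toFun := colA, map_zero' := colA_zero, map_add' := colA_add } :
    ((Fin q → ℕ) →₀ ℕ) →+ (Fin q → ℕ)) A s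

theorem colA_cyclePartition {N q : ℕ} (c : Fin N → Fin q) (π : Equiv.Perm (Fin N)) :
    colA (cyclePartition c π) = epsilonCount c Finset.univ := by
  rw [cyclePartition, colA_sum]
  funext j
  simp only [colA_single, Finset.sum_apply]
  rw [epsilonCount, Finset.card_eq_sum_card_fiberwise (f := cycleThrough π) (t := Finset.univ)
    fun _ _ => Finset.mem_coe.2 (Finset.mem_univ _)]
  refine Finset.sum_congr rfl fun C _ => ?_
  simp only [cycleColors, epsilonCount, cycleElems, Finset.filter_filter]
  exact congrArg _ (Finset.filter_congr fun _ _ => and_comm)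

/-- The number of elements lying on a cycle of color count `a`. -/
theorem card_filter_cycleColors_cycleThrough {N q : ℕ} (c : Fin N → Fin q)
    (π : Equiv.Perm (Fin N)) (a : Fin q → ℕ) :
    (Finset.univ.filter fun x => cycleColors c π (cycleThrough π x) = a).card =
      cyclePartition c π a * ∑ j, a j := by
  rw [cyclePartition_apply, Finset.card_eq_sum_card_fiberwise (f := cycleThrough π)
    (t := Finset.univ.filter fun C => cycleColors c π C = a)]
  · rw [← smul_eq_mul, ← Finset.sum_const]
    refine Finset.sum_congr rfl fun C hC => ?_
    rw [Finset.mem_filter] at hC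
    rw [← hC.2, sum_cycleColors, cycleElems, Finset.filter_filter]
    refine congrArg _ (Finset.filter_congr fun x _ => ⟨fun h => h.2, fun h => ⟨by rw [h], h⟩⟩)
  · intro x hx
    simpa using hx

theorem cycleColors_cycleThrough {N q : ℕ} (c : Fin N → Fin q) (π : Equiv.Perm (Fin N))
    (y : Fin N) (j : Fin q) :
    cycleColors c π (cycleThrough π y) j =
      ∑ x, if π.SameCycle x y ∧ c x = j then 1 else 0 := by
  rw [cycleColors, epsilonCount, cycleElems, Finset.filter_filter, Finset.card_filter]
  simp only [cycleThrough_eq_iff]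

/-- A map that sends each step of `π` into a cycle of `τ` sends cycles into cycles. -/
theorem sameCycle_map {α β : Type*} {π : Equiv.Perm α} {τ : Equiv.Perm β} (f : α → β)
    (hf : ∀ x, τ.SameCycle (f x) (f (π x))) {x y : α} (h : π.SameCycle x y) :
    τ.SameCycle (f x) (f y) := by
  have hpow : ∀ (m : ℕ) (z : α), τ.SameCycle (f z) (f ((π ^ m) z)) := by
    intro m
    induction m with
    | zero => exact fun z => Equiv.Perm.SameCycle.refl _ _
    | succ m ih =>
      intro z
      rw [_root_.pow_succ', Equiv.Perm.mul_apply]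
      exact (ih z).trans (hf _)
  obtain ⟨m, hm⟩ := h
  obtain ⟨k, rfl | rfl⟩ := m.eq_nat_or_neg
  · rw [← hm]
    exact hpow k x
  · have hy : (π ^ k) y = x := by
      rw [← hm, zpow_neg, zpow_natCast, ← Equiv.Perm.mul_apply, mul_inv_cancel,
        Equiv.Perm.one_apply]
    rw [← hy]
    exact (hpow k y).symm

theorem sameCycle_zero_decomposeFin_succ {N : ℕ} (y : Fin N) (σ : Equiv.Perm (Fin N)) :
    (Equiv.Perm.decomposeFin.symm (y.succ, σ)).SameCycle 0 y.succ := by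
  refine ⟨1, ?_⟩
  rw [zpow_one, Equiv.Perm.decomposeFin_symm_apply_zero]

theorem sameCycle_decomposeFin_succ {N : ℕ} (y : Fin N) (σ : Equiv.Perm (Fin N)) (z w : Fin N) :
    (Equiv.Perm.decomposeFin.symm (y.succ, σ)).SameCycle z.succ w.succ ↔ σ.SameCycle z w := by
  constructor
  · intro h
    refine sameCycle_map (Fin.cases y id) (fun x => ?_) h
    refine Fin.cases ?_ (fun x => ?_) x
    · rw [Equiv.Perm.decomposeFin_symm_apply_zero]
      exact Equiv.Perm.SameCycle.refl _ _
    · rw [Equiv.Perm.decomposeFin_symm_apply_succ]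
      by_cases hx : σ x = y
      · rw [hx, Equiv.swap_apply_right]
        exact ⟨1, hx⟩
      · rw [Equiv.swap_apply_of_ne_of_ne (Fin.succ_ne_zero _) (by simpa using hx)]
        exact ⟨1, rfl⟩
  · intro h
    refine sameCycle_map Fin.succ (fun x => ?_) h
    by_cases hx : σ x = y
    · refine Equiv.Perm.SameCycle.trans ?_ (sameCycle_zero_decomposeFin_succ y σ |>.trans
        (hx ▸ Equiv.Perm.SameCycle.refl _ _))
      refine ⟨1, ?_⟩
      rw [zpow_one, Equiv.Perm.decomposeFin_symm_apply_succ, hx, Equiv.swap_apply_right]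
    · refine ⟨1, ?_⟩
      rw [zpow_one, Equiv.Perm.decomposeFin_symm_apply_succ,
        Equiv.swap_apply_of_ne_of_ne (Fin.succ_ne_zero _) (by simpa using hx)]

theorem sameCycle_decomposeFin_zero {N : ℕ} (σ : Equiv.Perm (Fin N)) (z w : Fin N) :
    (Equiv.Perm.decomposeFin.symm (0, σ)).SameCycle z.succ w.succ ↔ σ.SameCycle z w := by
  constructor
  · intro h
    refine sameCycle_map (Fin.cases z id) (fun x => ?_) h
    refine Fin.cases ?_ (fun x => ?_) x
    · rw [Equiv.Perm.decomposeFin_symm_apply_zero]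
    · rw [Equiv.Perm.decomposeFin_symm_apply_succ, Equiv.swap_self]
      exact ⟨1, rfl⟩
  · intro h
    refine sameCycle_map Fin.succ (fun x => ⟨1, ?_⟩) h
    rw [zpow_one, Equiv.Perm.decomposeFin_symm_apply_succ, Equiv.swap_self, Equiv.refl_apply]

theorem not_sameCycle_decomposeFin_zero {N : ℕ} (σ : Equiv.Perm (Fin N)) (z : Fin N) :
    ¬ (Equiv.Perm.decomposeFin.symm (0, σ)).SameCycle 0 z.succ := fun h =>
  (Fin.succ_ne_zero z)
    (h.eq_of_left (Equiv.Perm.decomposeFin_symm_apply_zero 0 σ)).symm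

theorem cycleColors_decomposeFin_zero_zero {N q : ℕ} (c : Fin (N + 1) → Fin q)
    (σ : Equiv.Perm (Fin N)) :
    cycleColors c (Equiv.Perm.decomposeFin.symm (0, σ)) (cycleThrough _ 0) =
      Pi.single (c 0) 1 := by
  funext j
  rw [cycleColors_cycleThrough, Fin.sum_univ_succ]
  simp only [Equiv.Perm.SameCycle.refl, true_and, Pi.single_apply, eq_comm (a := j)]
  rw [Finset.sum_eq_zero, add_zero]
  exact fun z _ => if_neg fun h => not_sameCycle_decomposeFin_zero σ z h.1.symm

theorem cycleColors_decomposeFin_zero_succ {N q : ℕ} (c : Fin (N + 1) → Fin q)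
    (σ : Equiv.Perm (Fin N)) (z : Fin N) :
    cycleColors c (Equiv.Perm.decomposeFin.symm (0, σ)) (cycleThrough _ z.succ) =
      cycleColors (fun x => c x.succ) σ (cycleThrough σ z) := by
  funext j
  rw [cycleColors_cycleThrough, cycleColors_cycleThrough, Fin.sum_univ_succ,
    if_neg fun h => not_sameCycle_decomposeFin_zero σ z h.1, zero_add]
  simp only [sameCycle_decomposeFin_zero]

theorem cycleColors_decomposeFin_succ {N q : ℕ} (c : Fin (N + 1) → Fin q)
    (σ : Equiv.Perm (Fin N)) (y z : Fin N) :
    cycleColors c (Equiv.Perm.decomposeFin.symm (y.succ, σ)) (cycleThrough _ z.succ) =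
      cycleColors (fun x => c x.succ) σ (cycleThrough σ z) +
        if cycleThrough σ z = cycleThrough σ y then Pi.single (c 0) 1 else 0 := by
  have hzero : (Equiv.Perm.decomposeFin.symm (y.succ, σ)).SameCycle 0 z.succ ↔
      cycleThrough σ z = cycleThrough σ y := by
    rw [cycleThrough_eq_iff, ← sameCycle_decomposeFin_succ y]
    have h := sameCycle_zero_decomposeFin_succ y σ
    exact ⟨fun h' => h'.symm.trans h, fun h' => h.trans h'.symm⟩
  funext j
  rw [Pi.add_apply, cycleColors_cycleThrough, cycleColors_cycleThrough, Fin.sum_univ_succ,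
    add_comm]
  simp only [sameCycle_decomposeFin_succ, hzero]
  congr 1
  by_cases h : cycleThrough σ z = cycleThrough σ y
  · simp [h, Pi.single_apply, eq_comm]
  · simp [h]

theorem cycleColors_decomposeFin_succ_zero {N q : ℕ} (c : Fin (N + 1) → Fin q)
    (σ : Equiv.Perm (Fin N)) (y : Fin N) :
    cycleColors c (Equiv.Perm.decomposeFin.symm (y.succ, σ)) (cycleThrough _ 0) =
      cycleColors (fun x => c x.succ) σ (cycleThrough σ y) + Pi.single (c 0) 1 := by
  rw [cycleThrough_eq_iff.2 (sameCycle_zero_decomposeFin_succ y σ),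
    cycleColors_decomposeFin_succ, if_pos rfl]

theorem cyclePartition_decomposeFin_zero {N q : ℕ} (c : Fin (N + 1) → Fin q)
    (σ : Equiv.Perm (Fin N)) :
    cyclePartition c (Equiv.Perm.decomposeFin.symm (0, σ)) =
      cyclePartition (fun x => c x.succ) σ + Finsupp.single (Pi.single (c 0) 1) 1 := by
  let F : Option (Cycles σ) → Cycles (Equiv.Perm.decomposeFin.symm (0, σ)) := fun o =>
    o.elim (cycleThrough _ 0)
      (Quotient.map Fin.succ fun a b h => (sameCycle_decomposeFin_zero σ a b).2 h)
  have hF : Function.Bijective F := by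
    constructor
    · rintro (_ | C) (_ | D) h
      · rfl
      · obtain ⟨z, rfl⟩ := cycleThrough_surjective σ D
        exact absurd (cycleThrough_eq_iff.1 h) (not_sameCycle_decomposeFin_zero σ z)
      · obtain ⟨z, rfl⟩ := cycleThrough_surjective σ C
        exact absurd (cycleThrough_eq_iff.1 h).symm (not_sameCycle_decomposeFin_zero σ z)
      · obtain ⟨z, rfl⟩ := cycleThrough_surjective σ C
        obtain ⟨w, rfl⟩ := cycleThrough_surjective σ D
        exact congrArg some (cycleThrough_eq_iff.2
          ((sameCycle_decomposeFin_zero σ z w).1 (cycleThrough_eq_iff.1 h)))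
    · intro C
      obtain ⟨x, rfl⟩ := cycleThrough_surjective _ C
      exact Fin.cases ⟨none, rfl⟩ (fun z => ⟨some (cycleThrough σ z), rfl⟩) x
  rw [cyclePartition, cyclePartition, ← hF.sum_comp, Fintype.sum_option, add_comm]
  congr 1
  · refine Finset.sum_congr rfl fun C _ => ?_
    obtain ⟨z, rfl⟩ := cycleThrough_surjective σ C
    rw [← cycleColors_decomposeFin_zero_succ]
    rfl
  · rw [← cycleColors_decomposeFin_zero_zero c σ]
    rfl

theorem cyclePartition_decomposeFin_succ {N q : ℕ} (c : Fin (N + 1) → Fin q)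
    (σ : Equiv.Perm (Fin N)) (y : Fin N) :
    cyclePartition c (Equiv.Perm.decomposeFin.symm (y.succ, σ)) +
        Finsupp.single (cycleColors (fun x => c x.succ) σ (cycleThrough σ y)) 1 =
      cyclePartition (fun x => c x.succ) σ +
        Finsupp.single (cycleColors (fun x => c x.succ) σ (cycleThrough σ y) +
          Pi.single (c 0) 1) 1 := by
  let F : Cycles σ → Cycles (Equiv.Perm.decomposeFin.symm (y.succ, σ)) :=
    Quotient.map Fin.succ fun a b h => (sameCycle_decomposeFin_succ y σ a b).2 h
  have hF : Function.Bijective F := by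
    constructor
    · intro C D h
      obtain ⟨z, rfl⟩ := cycleThrough_surjective σ C
      obtain ⟨w, rfl⟩ := cycleThrough_surjective σ D
      exact cycleThrough_eq_iff.2
        ((sameCycle_decomposeFin_succ y σ z w).1 (cycleThrough_eq_iff.1 h))
    · intro C
      obtain ⟨x, rfl⟩ := cycleThrough_surjective _ C
      exact Fin.cases ⟨cycleThrough σ y,
          (cycleThrough_eq_iff.2 (sameCycle_zero_decomposeFin_succ y σ)).symm⟩
        (fun z => ⟨cycleThrough σ z, rfl⟩) x
  have hcolors : ∀ C, cycleColors c (Equiv.Perm.decomposeFin.symm (y.succ, σ)) (F C) =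
      cycleColors (fun x => c x.succ) σ C +
        if C = cycleThrough σ y then Pi.single (c 0) 1 else 0 := by
    intro C
    obtain ⟨z, rfl⟩ := cycleThrough_surjective σ C
    exact cycleColors_decomposeFin_succ c σ y z
  rw [cyclePartition, cyclePartition, ← hF.sum_comp,
    ← Finset.add_sum_erase _ _ (Finset.mem_univ (cycleThrough σ y)),
    ← Finset.add_sum_erase (a := cycleThrough σ y) Finset.univ
      (fun C => Finsupp.single (cycleColors (fun x => c x.succ) σ C) 1) (Finset.mem_univ _),
    hcolors, if_pos rfl, add_right_comm, add_comm (Finsupp.single _ _), add_right_comm,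
    add_right_comm]
  rw [Finset.sum_congr rfl fun C hC => by
    rw [hcolors, if_neg (Finset.ne_of_mem_erase hC), add_zero]]
  abel

/-- The factor of `M_𝐧(A)` depending only on `A`. -/
noncomputable def partitionWeight {q : ℕ} (A : (Fin q → ℕ) →₀ ℕ) : ℝ :=
  A.prod fun a k => (Nat.multinomial Finset.univ a : ℝ) ^ k / ((∑ j, a j : ℝ) ^ k * k !)

theorem Mcoef_eq {q : ℕ} (n : Fin q → ℕ) (A : (Fin q → ℕ) →₀ ℕ) :
    Mcoef n A = (∏ j, (n j)! : ℝ) * partitionWeight A :=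
  rfl

theorem partitionWeight_add_single {q : ℕ} (A : (Fin q → ℕ) →₀ ℕ) (a : Fin q → ℕ) :
    partitionWeight (A + Finsupp.single a 1) * (A a + 1 : ℝ) =
      partitionWeight A * (Nat.multinomial Finset.univ a / (∑ j, a j : ℝ)) := by
  set g : (Fin q → ℕ) → ℕ → ℝ := fun a k =>
    (Nat.multinomial Finset.univ a : ℝ) ^ k / ((∑ j, a j : ℝ) ^ k * k !) with hg
  have hprod : ∀ B : (Fin q → ℕ) →₀ ℕ, B.support ⊆ insert a A.support →
      partitionWeight B = g a (B a) * ∏ b ∈ (insert a A.support).erase a, g b (B b) := by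
    intro B hB
    rw [partitionWeight, Finsupp.prod_of_support_subset B hB g (by simp [hg]),
      Finset.mul_prod_erase _ (fun b => g b (B b)) (Finset.mem_insert_self _ _)]
  rw [hprod A (Finset.subset_insert _ _), hprod (A + Finsupp.single a 1)]
  · have herase : ∏ b ∈ (insert a A.support).erase a,
        g b ((A + Finsupp.single a 1 : (Fin q → ℕ) →₀ ℕ) b) =
        ∏ b ∈ (insert a A.support).erase a, g b (A b) := by
      refine Finset.prod_congr rfl fun b hb => ?_
      rw [Finsupp.add_apply, Finsupp.single_eq_of_ne (Finset.ne_of_mem_erase hb), add_zero]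
    rw [herase, Finsupp.add_apply, Finsupp.single_eq_same]
    have hstep : g a (A a + 1) * (A a + 1 : ℝ) =
        g a (A a) * (Nat.multinomial Finset.univ a / (∑ j, a j : ℝ)) := by
      have : (A a + 1 : ℝ) ≠ 0 := by positivity
      have : ((A a)! : ℝ) ≠ 0 := by positivity
      simp only [hg, Nat.factorial_succ, Nat.cast_mul, Nat.cast_add, Nat.cast_one,
        _root_.pow_succ]
      by_cases hs : (∑ j, a j : ℝ) = 0
      · simp [hs]
      · field_simp
    linear_combination (∏ b ∈ (insert a A.support).erase a, g b (A b)) * hstep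
  · intro b hb
    rw [Finset.mem_insert, Finsupp.mem_support_iff]
    by_contra! h
    rw [Finsupp.mem_support_iff, Finsupp.add_apply, Finsupp.single_eq_of_ne h.1, h.2] at hb
    exact hb rfl

theorem prod_factorial_add_single {q : ℕ} (b : Fin q → ℕ) (j : Fin q) :
    ∏ i, ((b + Pi.single j 1 : Fin q → ℕ) i)! = (∏ i, (b i)!) * (b j + 1) := by
  rw [← Finset.mul_prod_erase _ _ (Finset.mem_univ j),
    ← Finset.mul_prod_erase Finset.univ (fun i => (b i)!) (Finset.mem_univ j)]
  rw [Finset.prod_congr rfl fun i hi => by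
    rw [Pi.add_apply, Pi.single_eq_of_ne (Finset.ne_of_mem_erase hi), add_zero]]
  simp only [Pi.add_apply, Pi.single_eq_same, Nat.factorial_succ]
  ring

theorem multinomial_add_single {q : ℕ} (b : Fin q → ℕ) (j : Fin q) :
    Nat.multinomial Finset.univ (b + Pi.single j 1) * (b j + 1) =
      Nat.multinomial Finset.univ b * (∑ i, b i + 1) := by
  have hb := Nat.multinomial_spec Finset.univ b
  have ha := Nat.multinomial_spec Finset.univ (b + Pi.single j 1)
  have hsum : ∑ i, (b + Pi.single j 1 : Fin q → ℕ) i = ∑ i, b i + 1 := by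
    simp [Finset.sum_add_distrib]
  rw [hsum, Nat.factorial_succ, prod_factorial_add_single, ← hb] at ha
  refine Nat.eq_of_mul_eq_mul_left
    (Finset.prod_pos fun i (_ : i ∈ Finset.univ) => Nat.factorial_pos (b i)) ?_
  linarith

/-- Removing one element of color `j` from a part `b + e_j`. -/
theorem partitionWeight_shrink_part {q : ℕ} (A : (Fin q → ℕ) →₀ ℕ) (b : Fin q → ℕ) (j : Fin q)
    (hb : b ≠ 0) :
    partitionWeight (A + Finsupp.single b 1) * ((A b + 1) * ∑ i, (b i : ℝ)) =
      partitionWeight (A + Finsupp.single (b + Pi.single j 1) 1) *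
        ((A (b + Pi.single j 1) + 1) * (b j + 1)) := by
  have hsum : (∑ i, (b i : ℝ)) ≠ 0 := by
    intro h
    refine hb (funext fun i => ?_)
    rw [Finset.sum_eq_zero_iff_of_nonneg fun i _ => Nat.cast_nonneg (b i)] at h
    exact_mod_cast h i (Finset.mem_univ i)
  have hsum' : (∑ i, ((b + Pi.single j 1 : Fin q → ℕ) i : ℕ) : ℝ) = ∑ i, (b i : ℝ) + 1 := by
    rw [← Nat.cast_sum, ← Nat.cast_sum]
    simp [Finset.sum_add_distrib]
  have hpos : (∑ i, (b i : ℝ) + 1) ≠ 0 := by positivity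
  have hmul : (Nat.multinomial Finset.univ (b + Pi.single j 1) : ℝ) * (b j + 1) =
      Nat.multinomial Finset.univ b * (∑ i, (b i : ℝ) + 1) := by
    exact_mod_cast multinomial_add_single b j
  rw [← mul_assoc, ← mul_assoc, partitionWeight_add_single, partitionWeight_add_single, hsum',
    mul_assoc, mul_assoc, div_mul_cancel₀ _ hsum, div_mul_eq_mul_div, hmul,
    mul_div_cancel_right₀ _ hpos]

theorem partitionWeight_add_single_single {q : ℕ} (A : (Fin q → ℕ) →₀ ℕ) (j : Fin q) :
    partitionWeight (A + Finsupp.single (Pi.single j 1) 1) * (A (Pi.single j 1) + 1) =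
      partitionWeight A := by
  rw [partitionWeight_add_single, Nat.multinomial_single, ← Nat.cast_sum]
  simp

theorem card_filter_perm_fin_succ {N : ℕ} (P : Equiv.Perm (Fin (N + 1)) → Prop)
    [DecidablePred P] :
    (Finset.univ.filter P).card =
      (Finset.univ.filter fun σ => P (Equiv.Perm.decomposeFin.symm (0, σ))).card +
        ∑ σ, (Finset.univ.filter fun y : Fin N =>
          P (Equiv.Perm.decomposeFin.symm (y.succ, σ))).card := by
  simp only [Finset.card_filter]
  rw [← Equiv.sum_comp Equiv.Perm.decomposeFin.symm, Fintype.sum_prod_type, Fin.sum_univ_succ,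
    Finset.sum_comm (s := (Finset.univ : Finset (Fin N)))]

theorem card_cyclePartition_fixed_zero {N q : ℕ} (c : Fin (N + 1) → Fin q)
    (B : (Fin q → ℕ) →₀ ℕ) :
    (Finset.univ.filter fun π =>
        cyclePartition c π = B + Finsupp.single (Pi.single (c 0) 1) 1 ∧
          cycleColors c π (cycleThrough π 0) = Pi.single (c 0) 1).card =
      (Finset.univ.filter fun σ => cyclePartition (fun x => c x.succ) σ = B).card := by
  rw [card_filter_perm_fin_succ, Finset.sum_eq_zero, add_zero]
  · simp only [cyclePartition_decomposeFin_zero, cycleColors_decomposeFin_zero_zero,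
      add_left_inj, and_true]
  · intro σ _
    rw [Finset.card_eq_zero, Finset.filter_eq_empty_iff]
    rintro y - ⟨-, h⟩
    rw [cycleColors_decomposeFin_succ_zero, add_eq_right] at h
    exact cycleColors_ne_zero _ _ _ h

theorem card_cyclePartition_grow_part {N q : ℕ} (c : Fin (N + 1) → Fin q)
    (B : (Fin q → ℕ) →₀ ℕ) (b : Fin q → ℕ) (hb : b ≠ 0) :
    (Finset.univ.filter fun π =>
        cyclePartition c π = B + Finsupp.single (b + Pi.single (c 0) 1) 1 ∧
          cycleColors c π (cycleThrough π 0) = b + Pi.single (c 0) 1).card =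
      (Finset.univ.filter fun σ =>
        cyclePartition (fun x => c x.succ) σ = B + Finsupp.single b 1).card *
          ((B b + 1) * ∑ i, b i) := by
  rw [card_filter_perm_fin_succ, Finset.card_eq_zero.2, zero_add, ← smul_eq_mul,
    ← Finset.sum_const, Finset.sum_filter]
  · refine Finset.sum_congr rfl fun σ _ => ?_
    have hiff : ∀ y : Fin N,
        (cyclePartition c (Equiv.Perm.decomposeFin.symm (y.succ, σ)) =
            B + Finsupp.single (b + Pi.single (c 0) 1) 1 ∧
          cycleColors c (Equiv.Perm.decomposeFin.symm (y.succ, σ)) (cycleThrough _ 0) =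
            b + Pi.single (c 0) 1) ↔
        cyclePartition (fun x => c x.succ) σ = B + Finsupp.single b 1 ∧
          cycleColors (fun x => c x.succ) σ (cycleThrough σ y) = b := by
      intro y
      rw [cycleColors_decomposeFin_succ_zero, add_left_inj]
      refine and_congr_left fun h => ?_
      have hpart := cyclePartition_decomposeFin_succ c σ y
      rw [h] at hpart
      rw [← add_left_inj (Finsupp.single b 1), hpart, add_right_comm, add_left_inj]
    simp only [hiff]
    split_ifs with hσ
    · simp only [hσ, true_and]
      rw [card_filter_cycleColors_cycleThrough, hσ, Finsupp.add_apply, Finsupp.single_eq_same]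
    · simp [hσ]
  · rw [Finset.filter_eq_empty_iff]
    rintro σ - ⟨-, h⟩
    rw [cycleColors_decomposeFin_zero_zero, right_eq_add] at h
    exact hb h

theorem cycleColors_apply_pos {N q : ℕ} (c : Fin N → Fin q) (π : Equiv.Perm (Fin N))
    (x : Fin N) : 0 < cycleColors c π (cycleThrough π x) (c x) := by
  rw [cycleColors, epsilonCount, Finset.card_pos]
  exact ⟨x, Finset.mem_filter.2 ⟨mem_cycleElems.2 rfl, rfl⟩⟩

theorem epsilonCount_univ_succ {N q : ℕ} (c : Fin (N + 1) → Fin q) :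
    epsilonCount c Finset.univ =
      epsilonCount (fun x => c x.succ) Finset.univ + Pi.single (c 0) 1 := by
  funext j
  simp only [epsilonCount, Finset.card_filter, Fin.sum_univ_succ, Pi.add_apply, Pi.single_apply,
    eq_comm (a := j)]
  exact add_comm _ _

theorem eq_zero_of_colA_eq_zero {q : ℕ} {A : (Fin q → ℕ) →₀ ℕ} (hA : A 0 = 0)
    (hcol : colA A = 0) : A = 0 := by
  ext a
  by_contra h
  have ha : a = 0 := by
    funext j
    have hj := congrFun hcol j
    simp only [colA, Pi.zero_apply, Finset.sum_eq_zero_iff, mul_eq_zero] at hj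
    exact (hj a (Finsupp.mem_support_iff.2 h)).resolve_left h
  exact h (ha ▸ hA)

theorem card_cyclePartition_eq {N q : ℕ} (c : Fin N → Fin q) (A : (Fin q → ℕ) →₀ ℕ)
    (hA : A 0 = 0) (hcol : colA A = epsilonCount c Finset.univ) :
    ((Finset.univ.filter fun π => cyclePartition c π = A).card : ℝ) =
      Mcoef (epsilonCount c Finset.univ) A := by
  induction N generalizing A with
  | zero =>
    have hzero : epsilonCount c Finset.univ = 0 := by
      funext j
      simp [epsilonCount]
    obtain rfl := eq_zero_of_colA_eq_zero hA (hcol.trans hzero)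
    have hpart : ∀ π, cyclePartition c π = 0 := fun π =>
      eq_zero_of_colA_eq_zero (cyclePartition_zero c π)
        ((colA_cyclePartition c π).trans hzero)
    rw [hzero]
    simp [hpart, Mcoef]
  | succ N ih =>
    set n := epsilonCount c Finset.univ
    set n' := epsilonCount (fun x => c x.succ) Finset.univ
    have hsucc : n = n' + Pi.single (c 0) 1 := epsilonCount_univ_succ c
    have hnj : (n (c 0) : ℝ) = n' (c 0) + 1 := by simp [hsucc]
    have hfact : (∏ j, (n j)! : ℝ) = (∏ j, (n' j)! : ℝ) * n (c 0) := by
      rw [hnj, hsucc]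
      exact_mod_cast prod_factorial_add_single n' (c 0)
    have hterm : ∀ a ∈ A.support,
        ((Finset.univ.filter fun π => cyclePartition c π = A ∧
          cycleColors c π (cycleThrough π 0) = a).card : ℝ) * n (c 0) =
        Mcoef n A * ((A a : ℝ) * a (c 0)) := by
      intro a ha
      obtain ⟨B, rfl⟩ : ∃ B, A = B + Finsupp.single a 1 :=
        ⟨A - Finsupp.single a 1, (tsub_add_cancel_of_le (Finsupp.single_le_iff.2
          (Nat.one_le_iff_ne_zero.2 (Finsupp.mem_support_iff.1 ha)))).symm⟩
      have hB : B 0 = 0 := (Nat.add_eq_zero_iff.1 hA).1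
      rw [colA_add, colA_single, hsucc] at hcol
      rw [Finsupp.add_apply, Finsupp.single_eq_same, Mcoef_eq, hfact]
      by_cases haj : a (c 0) = 0
      · rw [Finset.card_eq_zero.2]
        · simp [haj]
        · rw [Finset.filter_eq_empty_iff]
          rintro π - ⟨-, h⟩
          exact (cycleColors_apply_pos c π 0).ne' (by rw [h, haj])
      obtain ⟨b, rfl⟩ : ∃ b, a = b + Pi.single (c 0) 1 := by
        refine ⟨a - Pi.single (c 0) 1, (tsub_add_cancel_of_le ?_).symm⟩
        intro i
        by_cases hi : i = c 0
        · subst hi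
          simpa using Nat.one_le_iff_ne_zero.2 haj
        · simp [hi]
      rw [← add_assoc, add_left_inj] at hcol
      by_cases hb : b = 0
      · subst hb
        rw [add_zero] at hcol
        have hcard := ih (fun x => c x.succ) B hB hcol
        rw [zero_add, card_cyclePartition_fixed_zero, hcard, Mcoef_eq,
          ← partitionWeight_add_single_single B (c 0)]
        simp only [Pi.single_eq_same, Nat.cast_add, Nat.cast_one]
        ring
      · have hcard := ih (fun x => c x.succ) (B + Finsupp.single b 1)
          (by rw [Finsupp.add_apply, hB, Finsupp.single_eq_of_ne (Ne.symm hb), add_zero])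
          (by rw [colA_add, colA_single, hcol])
        have hweight := partitionWeight_shrink_part B b (c 0) hb
        rw [card_cyclePartition_grow_part c B b hb, Nat.cast_mul, hcard, Mcoef_eq]
        simp only [Pi.add_apply, Pi.single_eq_same, Nat.cast_add, Nat.cast_one, Nat.cast_mul,
          Nat.cast_sum]
        linear_combination (∏ j, (n' j)! : ℝ) * n (c 0) * hweight
    have hsum : (Finset.univ.filter fun π => cyclePartition c π = A).card =
        ∑ a ∈ A.support, (Finset.univ.filter fun π => cyclePartition c π = A ∧
          cycleColors c π (cycleThrough π 0) = a).card := by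
      rw [Finset.card_eq_sum_card_fiberwise
        (f := fun π => cycleColors c π (cycleThrough π 0)) (t := A.support)]
      · simp only [Finset.filter_filter]
      · intro π hπ
        have hπ' : cyclePartition c π = A := by simpa using hπ
        rw [Finset.mem_coe, Finsupp.mem_support_iff, ← hπ', cyclePartition_apply]
        exact Finset.card_ne_zero_of_mem
          (Finset.mem_filter.2 ⟨Finset.mem_univ (cycleThrough π 0), rfl⟩)
    have hpos : (n (c 0) : ℝ) ≠ 0 := by
      rw [hnj]
      positivity
    refine mul_right_cancel₀ hpos ?_
    rw [hsum, Nat.cast_sum, Finset.sum_mul, Finset.sum_congr rfl hterm, ← Finset.mul_sum]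
    congr 1
    rw [← hcol, colA]
    push_cast
    rfl

theorem cyclePartition_eq_of_equiv {N q : ℕ} (c : Fin N → Fin q) {π τ : Equiv.Perm (Fin N)}
    (f : Equiv.Perm (Fin N)) (hf : ∀ x, c (f x) = c x)
    (h : ∀ x y, τ.SameCycle (f x) (f y) ↔ π.SameCycle x y) :
    cyclePartition c π = cyclePartition c τ := by
  let F : Cycles π ≃ Cycles τ := Quotient.congr f fun x y => (h x y).symm
  refine Fintype.sum_equiv F _ _ fun C => ?_
  congr 1
  obtain ⟨y, rfl⟩ := cycleThrough_surjective π C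
  have hF : F (cycleThrough π y) = cycleThrough τ (f y) := rfl
  funext j
  rw [hF, cycleColors_cycleThrough, cycleColors_cycleThrough,
    ← Equiv.sum_comp f fun x => if τ.SameCycle x (f y) ∧ c x = j then 1 else 0]
  simp only [h, hf]

theorem sameCycle_iff_of_isConj {N : ℕ} {π τ : Equiv.Perm (Fin N)} (hconj : IsConj π τ)
    (h : ∀ i j, π.SameCycle i j → τ.SameCycle i j) (i j : Fin N) :
    τ.SameCycle i j ↔ π.SameCycle i j := by
  refine ⟨fun hij => ?_, h i j⟩
  obtain ⟨g, rfl⟩ := isConj_iff.1 hconj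
  let e : Cycles π ≃ Cycles (g * π * g⁻¹) := Quotient.congr g fun x y => by
    change π.SameCycle x y ↔ (g * π * g⁻¹).SameCycle (g x) (g y)
    simp [Equiv.Perm.sameCycle_conj]
  let F : Cycles π → Cycles (g * π * g⁻¹) := Quotient.map id h
  have hsurj : Function.Surjective F := by
    intro C
    obtain ⟨x, rfl⟩ := cycleThrough_surjective _ C
    exact ⟨cycleThrough π x, rfl⟩
  have hinj : Function.Injective F := (hsurj.bijective_of_nat_card_le (Nat.card_congr e).le).1
  exact cycleThrough_eq_iff.1 (hinj (a₁ := cycleThrough π i) (a₂ := cycleThrough π j)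
    (cycleThrough_eq_iff.2 hij))

/-- Two maps with equinumerous fibers differ by a permutation of the source. -/
theorem exists_equiv_of_card_fiber_eq {α β : Type*} [Fintype α] (f g : α → β)
    (h : ∀ b, (Finset.univ.filter fun x => f x = b).card =
      (Finset.univ.filter fun x => g x = b).card) :
    ∃ e : Equiv.Perm α, ∀ x, g (e x) = f x := by
  have hfib : ∀ b, Nonempty ({x // f x = b} ≃ {x // g x = b}) := fun b =>
    ⟨Fintype.equivOfCardEq (by rw [Fintype.card_subtype, Fintype.card_subtype, h b])⟩
  refine ⟨(Equiv.sigmaFiberEquiv f).symm.trans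
    ((Equiv.sigmaCongrRight fun b => (hfib b).some).trans (Equiv.sigmaFiberEquiv g)), fun x => ?_⟩
  exact ((hfib (f x)).some ⟨x, rfl⟩).2

theorem exists_equiv_cycles {N q : ℕ} (c : Fin N → Fin q) {π τ : Equiv.Perm (Fin N)}
    (h : cyclePartition c π = cyclePartition c τ) :
    ∃ F : Cycles π ≃ Cycles τ, ∀ C, cycleColors c τ (F C) = cycleColors c π C := by
  have hfib : ∀ a, Nonempty ({C // cycleColors c π C = a} ≃ {C // cycleColors c τ C = a}) :=
    fun a => ⟨Fintype.equivOfCardEq (by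
      rw [Fintype.card_subtype, Fintype.card_subtype, ← cyclePartition_apply,
        ← cyclePartition_apply, h])⟩
  refine ⟨(Equiv.sigmaFiberEquiv (cycleColors c π)).symm.trans
    ((Equiv.sigmaCongrRight fun a => (hfib a).some).trans
      (Equiv.sigmaFiberEquiv (cycleColors c τ))), fun C => ?_⟩
  exact ((hfib (cycleColors c π C)).some ⟨C, rfl⟩).2

theorem exists_colored_equiv {N q : ℕ} (c : Fin N → Fin q) {π τ : Equiv.Perm (Fin N)}
    (h : cyclePartition c π = cyclePartition c τ) :
    ∃ σ : Equiv.Perm (Fin N), (∀ x, c (σ x) = c x) ∧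
      ∀ x y, τ.SameCycle (σ x) (σ y) ↔ π.SameCycle x y := by
  obtain ⟨F, hF⟩ := exists_equiv_cycles c h
  obtain ⟨σ, hσ⟩ := exists_equiv_of_card_fiber_eq
    (fun x => (F (cycleThrough π x), c x)) (fun x => (cycleThrough τ x, c x)) (by
      rintro ⟨D, j⟩
      obtain ⟨C, rfl⟩ := F.surjective D
      have hj := congrFun (hF C) j
      simp only [cycleColors, epsilonCount, cycleElems, Finset.filter_filter] at hj
      simp only [Prod.mk.injEq, F.injective.eq_iff]
      exact hj.symm)
  simp only [Prod.mk.injEq] at hσ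
  refine ⟨σ, fun x => (hσ x).2, fun x y => ?_⟩
  rw [← cycleThrough_eq_iff, (hσ x).1, (hσ y).1, F.injective.eq_iff, cycleThrough_eq_iff]

theorem cycleType_eq_map_card {N : ℕ} (π : Equiv.Perm (Fin N)) :
    π.cycleType = (π.cycleFactorsFinset.image Equiv.Perm.support).val.map Finset.card := by
  rw [Finset.image_val_of_injOn (support_injOn_cycleFactorsFinset π), Multiset.map_map,
    Equiv.Perm.cycleType]

/-- Permutations with the same cycles, as sets, are conjugate. -/
theorem isConj_of_sameCycle_iff {N : ℕ} {π τ : Equiv.Perm (Fin N)}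
    (h : ∀ x y, τ.SameCycle x y ↔ π.SameCycle x y) : IsConj π τ := by
  have hsupport : π.support = τ.support := by
    ext x
    rw [Equiv.Perm.mem_support, Equiv.Perm.mem_support, not_iff_not]
    exact ⟨fun hx => (((h x (τ x)).1 ⟨1, rfl⟩).eq_of_left hx).symm,
      fun hx => (((h x (π x)).2 ⟨1, rfl⟩).eq_of_left hx).symm⟩
  have helems : ∀ x, cycleElems π (cycleThrough π x) = cycleElems τ (cycleThrough τ x) := by
    intro x
    ext y
    rw [mem_cycleElems_cycleThrough, mem_cycleElems_cycleThrough, h]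
  rw [Equiv.Perm.isConj_iff_cycleType_eq, cycleType_eq_map_card, cycleType_eq_map_card,
    image_support_cycleFactorsFinset, image_support_cycleFactorsFinset, hsupport]
  simp only [helems]

theorem swap_mem_Hset {N : ℕ} {π τ : Equiv.Perm (Fin N)}
    (h : ∀ x y, τ.SameCycle x y ↔ π.SameCycle x y) : Equiv.swap π τ ∈ Hset N := by
  refine ⟨fun ρ => ?_, fun ρ i j hij => ?_⟩
  · by_cases h₁ : ρ = π
    · rw [h₁, Equiv.swap_apply_left]
      exact isConj_of_sameCycle_iff h
    by_cases h₂ : ρ = τ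
    · rw [h₂, Equiv.swap_apply_right]
      exact (isConj_of_sameCycle_iff h).symm
    · rw [Equiv.swap_apply_of_ne_of_ne h₁ h₂]
  · by_cases h₁ : ρ = π
    · rw [h₁, Equiv.swap_apply_left]
      exact (h i j).2 (h₁ ▸ hij)
    by_cases h₂ : ρ = τ
    · rw [h₂, Equiv.swap_apply_right]
      exact (h i j).1 (h₂ ▸ hij)
    · rwa [Equiv.swap_apply_of_ne_of_ne h₁ h₂]

theorem orbit_eq_fiber {N q : ℕ} (c : Fin N → Fin q) (π : Equiv.Perm (Fin N)) :
    {π' : Equiv.Perm (Fin N) | ∃ h ∈ Hset N, ∃ σ : Equiv.Perm (Fin N),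
      (∀ i, c (σ i) = c i) ∧ π' = h (σ * π * σ⁻¹)} = {π' | Ppi c π' = Ppi c π} := by
  ext π'
  simp only [Set.mem_ofPred_eq, Ppi_eq_cyclePartition]
  constructor
  · rintro ⟨h, hh, σ, hσ, rfl⟩
    have hconj : cyclePartition c π = cyclePartition c (σ * π * σ⁻¹) :=
      cyclePartition_eq_of_equiv c σ hσ fun x y => by simp [Equiv.Perm.sameCycle_conj]
    rw [hconj]
    exact (cyclePartition_eq_of_equiv c 1 (fun _ => rfl)
      (sameCycle_iff_of_isConj (hh.1 _) (hh.2 _))).symm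
  · intro h
    obtain ⟨σ, hσ, hcycle⟩ := exists_colored_equiv c h.symm
    refine ⟨Equiv.swap (σ * π * σ⁻¹) π', swap_mem_Hset fun x y => ?_, σ, hσ,
      (Equiv.swap_apply_left _ _).symm⟩
    rw [Equiv.Perm.sameCycle_conj, ← hcycle]
    simp

/-- **Counting permutations with a given coloring.** For every `q`-colored partition `A`
of `𝐧`, the number of `π ∈ S_{|𝐧|}` with `Π(π) = A` equals `M_𝐧(A)`; equivalently each
orbit of `G_𝐧 = H_{|𝐧|} ⋊ S_𝐧` (acting by `(h,σ).π = h(σπσ⁻¹)`) through `π` has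
cardinality `M_𝐧(Π(π))`. -/
theorem card_fiber_Ppi (q : ℕ) (n : Fin q → ℕ) (c : Fin (∑ j, n j) → Fin q)
    (hc : ∀ j, (Finset.univ.filter fun i => c i = j).card = n j) :
    (∀ A ∈ CPartSet n,
      (({π : Equiv.Perm (Fin (∑ j, n j)) | Ppi c π = A}.ncard : ℝ)) = Mcoef n A) ∧
    (∀ π : Equiv.Perm (Fin (∑ j, n j)),
      (({π' : Equiv.Perm (Fin (∑ j, n j)) |
          ∃ h ∈ Hset (∑ j, n j), ∃ σ : Equiv.Perm (Fin (∑ j, n j)),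
            (∀ i, c (σ i) = c i) ∧ π' = h (σ * π * σ⁻¹)}.ncard : ℝ)) =
        Mcoef n (Ppi c π)) := by
  have heps : epsilonCount c Finset.univ = n := funext hc
  have hfiber : ∀ A ∈ CPartSet n,
      (({π : Equiv.Perm (Fin (∑ j, n j)) | Ppi c π = A}.ncard : ℝ)) = Mcoef n A := by
    rintro A ⟨hA, hcol⟩
    rw [Set.ncard_eq_toFinset_card', Set.toFinset_ofPred]
    simp only [Ppi_eq_cyclePartition]
    rw [card_cyclePartition_eq c A hA (hcol.trans heps.symm), heps]
  refine ⟨hfiber, fun π => ?_⟩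
  rw [orbit_eq_fiber c π]
  refine hfiber _ ⟨?_, ?_⟩
  · rw [Ppi_eq_cyclePartition, cyclePartition_zero]
  · rw [Ppi_eq_cyclePartition, colA_cyclePartition, heps]
end
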